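/- Let k ≥ 2 and suppose E[ξ^{k+1}] < ∞. Then there exists β_k > 0 such that for all t ≥ 1 and all n ∈ I, the probability under τ_n that N_k ≥ t is at most β_k·t^{(1−k)/2}. If E[ξ^{(3k+1)/2}] < ∞, the corresponding bound holds for the probability that N_{k+} ≥ t, with β_k replaced by some larger constant β_{k+}. Similarly, if E[ξ^{k+2}] < ∞ there is a constant β > 0 with E_{τ_n}[ξ_ε·1_{N_k ≥ t}] ≤ β·t^{(1−k)/2} for all t ≥ 1 and n ∈ I, and if E[ξ^{(3k+3)/2}] < ∞ the same holds with N_k replaced by N_{k+} (with a possibly larger constant). -/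

import Mathlib

/-! Finite ordered rooted (plane) trees: a tree is a finite list of its root subtrees. -/
inductive PTree : Type where
  | node : List PTree → PTree

namespace PTree

/-- the number of nodes of the tree -/
def size : PTree → ℕ
  | node ts => 1 + (ts.attach.map (fun x => size x.1)).sum
decreasing_by
  have := List.sizeOf_lt_of_mem x.2
  simp only [node.sizeOf_spec]; omega

/-- the list of all subtrees rooted at the nodes of the tree -/
def subtrees : PTree → List PTree
  | node ts => node ts :: (ts.attach.map (fun x => subtrees x.1)).flatten
decreasing_by
  have := List.sizeOf_lt_of_mem x.2
  simp only [node.sizeOf_spec]; omega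

/-- the height of the tree (maximal distance from the root to a node) -/
def height : PTree → ℕ
  | node ts => (ts.attach.map (fun x => height x.1 + 1)).foldr max 0
decreasing_by
  have := List.sizeOf_lt_of_mem x.2
  simp only [node.sizeOf_spec]; omega

/-- the number of children of the root (`ξ_ε`) -/
def rootDeg : PTree → ℕ
  | node ts => ts.length

/-- the sizes of the subtrees rooted at the children of the root -/
def childSizes : PTree → List ℕ
  | node ts => ts.map size

/-- the sizes of the subtrees rooted at the children of the root,
sorted from largest to smallest -/
def sortedSizesDesc (T : PTree) : List ℕ :=
  T.childSizes.insertionSort (· ≥ ·)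

/-- `N_k`: the `k`-th largest among the sizes of the subtrees rooted at the children
of the root (`0` if there are fewer than `k` children) -/
def Nk (k : ℕ) (T : PTree) : ℕ := (sortedSizesDesc T).getD (k - 1) 0

/-- `N_{k+} = N_k + N_{k+1} + ⋯` -/
def NkPlus (k : ℕ) (T : PTree) : ℕ := ((sortedSizesDesc T).drop (k - 1)).sum

/-- the subtrees rooted at the nodes of the heavy path: starting at the root, always
continue to the first child of maximal subtree size -/
def heavyPath : PTree → List PTree
  | node ts =>
    node ts ::
      (match ts.attach.find? (fun x => x.1.size = ((ts.map size).foldr max 0)) with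
       | some x => heavyPath x.1
       | none => [])
decreasing_by
  have := List.sizeOf_lt_of_mem x.2
  simp only [node.sizeOf_spec]; omega

end PTree

/-- `Z_k`: the number of nodes `v` of the tree whose subtree has size `k` -/
def Zk (k : ℕ) (T : PTree) : ℕ := (T.subtrees.filter (fun s => s.size = k)).length

/-- the rank (`1` = largest) of the `i`-th child (0-based) among siblings whose subtree
sizes are given by the list `sizes`; ties are broken from left to right -/
def rankIn (sizes : List ℕ) (i : ℕ) : ℕ :=
  1 + ((List.range sizes.length).filter (fun j =>
        sizes.getD i 0 < sizes.getD j 0 ∨ (sizes.getD j 0 = sizes.getD i 0 ∧ j < i))).length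

mutual
/-- the number of nodes of the `k`-heavy tree: the root together with all nodes `v` such
that `v` and every non-root ancestor of `v` has rank at most `k` among its siblings -/
def heavySize (k : ℕ) : PTree → ℕ
  | .node ts => 1 + heavySizeAux k (ts.map PTree.size) 0 ts
def heavySizeAux (k : ℕ) (sizes : List ℕ) : ℕ → List PTree → ℕ
  | _, [] => 0
  | i, t :: rest =>
      (if rankIn sizes i ≤ k then heavySize k t else 0) + heavySizeAux k sizes (i + 1) rest
end

/-- `H*(v,ℓ)`: the height of the subtree rooted at the child of rank `ℓ` of the root of `v`
(`0` if there are fewer than `ℓ` children) -/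
def Hstar : PTree → ℕ → ℕ
  | .node ts, ℓ =>
    match (List.range ts.length).find? (fun i => rankIn (ts.map PTree.size) i = ℓ) with
    | some i => (ts.getD i (.node [])).height
    | none => 0

/-- the weight of a tree: the product over all nodes `v` of `p (number of children of v)` -/
noncomputable def weight (p : ℕ → ℝ) : PTree → ℝ
  | .node ts => p ts.length * (ts.attach.map (fun x => weight p x.1)).prod
decreasing_by
  have := List.sizeOf_lt_of_mem x.2
  simp only [PTree.node.sizeOf_spec]; omega

/-- the total weight of all trees of size `n` -/
noncomputable def treeSum (p : ℕ → ℝ) (n : ℕ) : ℝ :=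
  ∑' T : {T : PTree // T.size = n}, weight p T.1

/-- the probability of the event `A` under the conditional Galton-Watson tree `τ_n` -/
noncomputable def condProb (p : ℕ → ℝ) (n : ℕ) (A : PTree → Prop) : ℝ :=
  (∑' T : {T : PTree // T.size = n ∧ A T}, weight p T.1) / treeSum p n

/-- the expectation of `f` under the conditional Galton-Watson tree `τ_n` -/
noncomputable def condExp (p : ℕ → ℝ) (n : ℕ) (f : PTree → ℝ) : ℝ :=
  (∑' T : {T : PTree // T.size = n}, weight p T.1 * f T.1) / treeSum p n

/-- the variance of `f` under the conditional Galton-Watson tree `τ_n` -/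
noncomputable def condVar (p : ℕ → ℝ) (n : ℕ) (f : PTree → ℝ) : ℝ :=
  condExp p n (fun T => f T ^ 2) - (condExp p n f) ^ 2

/-- the set `I = {n ≥ 1 : Σ_{|T| = n} w(T) > 0}` of sizes of positive probability -/
def gwSupport (p : ℕ → ℝ) : Set ℕ := {n | 1 ≤ n ∧ 0 < treeSum p n}

/-- `P(S_m = x)` for the random walk `S_m = (ξ_1 - 1) + ⋯ + (ξ_m - 1)`, `ξ_i` i.i.d. `∼ p` -/
noncomputable def walkProb (p : ℕ → ℝ) (m : ℕ) (x : ℤ) : ℝ :=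
  ∑' a : Fin m → ℕ, if (∑ i, ((a i : ℤ) - 1)) = x then ∏ i, p (a i) else 0

/-- `I_n = {1 ≤ k ≤ n : P(S_{n-k} = 0) > 0}` -/
def walkSupportIn (p : ℕ → ℝ) (n : ℕ) : Set ℕ :=
  {k | 1 ≤ k ∧ k ≤ n ∧ 0 < walkProb p (n - k) 0}

/-- `h = gcd {i > 0 : p_i > 0}`, defined as the largest common divisor of the support -/
noncomputable def gcdSupp (p : ℕ → ℝ) : ℕ :=
  sSup {d : ℕ | 0 < d ∧ ∀ i : ℕ, 0 < i → 0 < p i → d ∣ i}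

/-- `α = h / (σ √(2π))` where `σ² = Σ i² p_i - 1` -/
noncomputable def gwAlpha (p : ℕ → ℝ) : ℝ :=
  (gcdSupp p : ℝ) /
    (Real.sqrt ((∑' i : ℕ, (i : ℝ) ^ 2 * p i) - 1) * Real.sqrt (2 * Real.pi))

/-- the moment `E[ξ^m] = Σ i^m p_i` is finite -/
def MomentFinite (p : ℕ → ℝ) (m : ℝ) : Prop :=
  Summable (fun i : ℕ => (i : ℝ) ^ m * p i)

section LocalLimit

open Filter Topology MeasureTheory

/-- The generating function of `q` on the unit circle. -/
noncomputable def circleGen (q : ℕ → ℝ) (θ : ℝ) : ℂ :=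
  ∑' j : ℕ, (q j : ℂ) * Complex.exp (θ * Complex.I) ^ j

lemma norm_mul_exp_pow (x θ : ℝ) (j : ℕ) :
    ‖(x : ℂ) * Complex.exp (θ * Complex.I) ^ j‖ = |x| := by
  rw [norm_mul, norm_pow, Complex.norm_exp_ofReal_mul_I]; simp

lemma coeff_mk_pow_nonneg {q : ℕ → ℝ} (hq : ∀ j, 0 ≤ q j) (n N : ℕ) :
    0 ≤ (PowerSeries.mk q ^ n).coeff N := by
  rw [PowerSeries.coeff_pow]
  exact Finset.sum_nonneg fun l _ => Finset.prod_nonneg fun i _ => by simpa using hq _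

lemma hasSum_coeff_mk_pow {q : ℕ → ℝ} (hs : Summable q) (n : ℕ) :
    Summable (fun N => (PowerSeries.mk q ^ n).coeff N) ∧
    ∀ θ : ℝ, HasSum (fun N => ((PowerSeries.mk q ^ n).coeff N : ℂ) *
      Complex.exp (θ * Complex.I) ^ N) (circleGen q θ ^ n) := by
  induction n with
  | zero =>
    constructor
    · simp only [pow_zero, PowerSeries.coeff_one]
      exact (hasSum_ite_eq 0 (1 : ℝ)).summable
    · intro θ
      simp only [pow_zero, PowerSeries.coeff_one]
      convert hasSum_ite_eq 0 (1 : ℂ) using 2 with N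
      split_ifs with h <;> simp [h]
  | succ n ih =>
    obtain ⟨ih1, ih2⟩ := ih
    have h1n : Summable (fun N => ‖(PowerSeries.mk q ^ n).coeff N‖) := ih1.norm
    have hsn : Summable (fun N => ‖q N‖) := hs.norm
    constructor
    · have := (summable_norm_sum_mul_antidiagonal_of_summable_norm h1n hsn).of_norm
      refine this.congr fun N => ?_
      rw [pow_succ, PowerSeries.coeff_mul]
      simp
    · intro θ
      have hf : Summable (fun N => ‖((PowerSeries.mk q ^ n).coeff N : ℂ) *
          Complex.exp (θ * Complex.I) ^ N‖) := by
        simpa only [norm_mul_exp_pow, Real.norm_eq_abs] using h1n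
      have hg : Summable (fun N => ‖(q N : ℂ) * Complex.exp (θ * Complex.I) ^ N‖) := by
        simpa only [norm_mul_exp_pow, Real.norm_eq_abs] using hsn
      have h := (summable_norm_sum_mul_antidiagonal_of_summable_norm hf hg).of_norm.hasSum
      rw [← tsum_mul_tsum_eq_tsum_sum_antidiagonal_of_summable_norm hf hg, (ih2 θ).tsum_eq] at h
      rw [pow_succ]
      refine h.congr_fun fun N => ?_
      rw [PowerSeries.coeff_mul]
      push_cast
      rw [Finset.sum_mul]
      refine Finset.sum_congr rfl fun x hx => ?_
      rw [← Finset.HasAntidiagonal.mem_antidiagonal.1 hx, pow_add]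
      simp
      ring

lemma continuous_circleGen {q : ℕ → ℝ} (hs : Summable q) : Continuous (circleGen q) := by
  unfold circleGen
  refine continuous_tsum (fun j => by fun_prop) hs.norm fun j θ => ?_
  rw [norm_mul_exp_pow, Real.norm_eq_abs]

lemma integral_exp_pow (m N : ℕ) :
    ∫ θ in (-Real.pi)..Real.pi, Complex.exp (θ * Complex.I) ^ m *
      Complex.exp (-(N * θ * Complex.I)) = if m = N then 2 * (Real.pi : ℂ) else 0 := by
  split_ifs with h
  · subst h
    have : ∀ θ : ℝ, Complex.exp (θ * Complex.I) ^ m *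
      Complex.exp (-(m * θ * Complex.I)) = 1 := by
      intro θ
      rw [← Complex.exp_nat_mul, ← Complex.exp_add, ← Complex.exp_zero]
      congr 1; ring
    simp only [this]
    simp; ring
  · have : ∀ θ : ℝ, Complex.exp (θ * Complex.I) ^ m *
      Complex.exp (-(N * θ * Complex.I)) = Complex.exp ((((m : ℂ) - N) * Complex.I) * θ) := by
      intro θ
      rw [← Complex.exp_nat_mul, ← Complex.exp_add]
      congr 1; ring
    simp only [this]
    rw [integral_exp_mul_complex]
    · have h2 : Complex.exp (((m : ℂ) - N) * Complex.I * (Real.pi : ℝ)) =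
          Complex.exp (((m : ℂ) - N) * Complex.I * ((-Real.pi : ℝ) : ℂ)) := by
        rw [Complex.exp_eq_exp_iff_exists_int]
        refine ⟨(m : ℤ) - N, ?_⟩
        push_cast; ring
      rw [h2]; simp
    · refine mul_ne_zero (sub_ne_zero.2 ?_) Complex.I_ne_zero
      exact_mod_cast h

lemma integral_circleGen_pow {q : ℕ → ℝ} (hs : Summable q) (n N : ℕ) :
    ∫ θ in (-Real.pi)..Real.pi, circleGen q θ ^ n * Complex.exp (-(N * θ * Complex.I)) =
      2 * (Real.pi : ℂ) * ((PowerSeries.mk q ^ n).coeff N : ℝ) := by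
  obtain ⟨h1, h2⟩ := hasSum_coeff_mk_pow hs n
  have := intervalIntegral.hasSum_integral_of_dominated_convergence (μ := volume)
    (a := -Real.pi) (b := Real.pi)
    (F := fun m θ => ((PowerSeries.mk q ^ n).coeff m : ℂ) * Complex.exp (θ * Complex.I) ^ m *
      Complex.exp (-(N * θ * Complex.I)))
    (f := fun θ => circleGen q θ ^ n * Complex.exp (-(N * θ * Complex.I)))
    (fun m _ => |(PowerSeries.mk q ^ n).coeff m|)
    (fun m => by
      apply Continuous.aestronglyMeasurable
      fun_prop)
    (fun m => by
      refine ae_of_all _ fun θ _ => ?_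
      rw [norm_mul, norm_mul_exp_pow]
      have : -((N : ℂ) * θ * Complex.I) = ((-(N * θ) : ℝ) : ℂ) * Complex.I := by push_cast; ring
      rw [this, Complex.norm_exp_ofReal_mul_I, mul_one])
    (ae_of_all _ fun θ _ => h1.abs)
    intervalIntegrable_const
    (ae_of_all _ fun θ _ => (h2 θ).mul_right _)
  rw [← this.tsum_eq]
  simp only [mul_assoc, intervalIntegral.integral_const_mul]
  have h3 : ∀ m : ℕ, ∫ θ in (-Real.pi)..Real.pi, Complex.exp (θ * Complex.I) ^ m *
      Complex.exp (-(N * (θ * Complex.I))) = if m = N then 2 * (Real.pi : ℂ) else 0 := by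
    intro m; rw [← integral_exp_pow]; simp only [mul_assoc]
  simp only [h3]
  rw [tsum_eq_single N]
  · simp; ring
  · intro m hm; simp [hm]

/-- A probability distribution on `ℕ` charging `0`, with finite second moment, whose support is not
contained in a proper sublattice of `ℤ`. -/
structure AperiodicLaw (q : ℕ → ℝ) : Prop where
  nonneg : ∀ j, 0 ≤ q j
  hasSum : HasSum q 1
  sq : Summable fun j : ℕ => (j : ℝ) ^ 2 * q j
  zero : q 0 ≠ 0
  aperiodic : ∀ θ : ℝ, (∀ j, q j ≠ 0 → Complex.exp (θ * Complex.I) ^ j = 1) →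
    Complex.exp (θ * Complex.I) = 1

lemma summable_mul_of_summable_sq {q : ℕ → ℝ} (hq : ∀ j, 0 ≤ q j)
    (hs : Summable fun j : ℕ => (j : ℝ) ^ 2 * q j) : Summable fun j : ℕ => (j : ℝ) * q j := by
  refine hs.of_nonneg_of_le (fun j => mul_nonneg (by positivity) (hq j)) fun j => ?_
  refine mul_le_mul_of_nonneg_right ?_ (hq j)
  exact_mod_cast Nat.le_self_pow two_ne_zero j

/-- The characteristic function of the centered law. -/
noncomputable def centeredGen (q : ℕ → ℝ) (θ : ℝ) : ℂ :=
  circleGen q θ * Complex.exp (((-((∑' j : ℕ, (j : ℝ) * q j) * θ) : ℝ) : ℂ) * Complex.I)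

lemma norm_centeredGen (q : ℕ → ℝ) (θ : ℝ) : ‖centeredGen q θ‖ = ‖circleGen q θ‖ := by
  rw [centeredGen, norm_mul, Complex.norm_exp_ofReal_mul_I, mul_one]

namespace AperiodicLaw

variable {q : ℕ → ℝ}

lemma continuous_centeredGen (h : AperiodicLaw q) : Continuous (centeredGen q) := by
  have := continuous_circleGen h.hasSum.summable
  unfold centeredGen
  fun_prop

lemma norm_circleGen_le_one (h : AperiodicLaw q) (θ : ℝ) : ‖circleGen q θ‖ ≤ 1 := by
  unfold circleGen
  have h1 : ∀ j, ‖(q j : ℂ) * Complex.exp (θ * Complex.I) ^ j‖ = q j := fun j => by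
    rw [norm_mul_exp_pow, abs_of_nonneg (h.nonneg j)]
  refine tsum_of_norm_bounded h.hasSum fun j => (h1 j).le

lemma norm_circleGen_lt_one (h : AperiodicLaw q) {θ : ℝ}
    (hθ : Complex.exp (θ * Complex.I) ≠ 1) : ‖circleGen q θ‖ < 1 := by
  refine lt_of_le_of_ne (h.norm_circleGen_le_one θ) fun h1 => hθ (h.aperiodic θ ?_)
  set z := Complex.exp (θ * Complex.I) with hz
  set u := (starRingEnd ℂ) (circleGen q θ) with hu
  have hun : ‖u‖ = 1 := by rw [hu, RCLike.norm_conj, h1]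
  have hzn : ‖z‖ = 1 := Complex.norm_exp_ofReal_mul_I θ
  have hsum : HasSum (fun j => (q j : ℂ) * z ^ j) (circleGen q θ) := by
    refine Summable.hasSum (Summable.of_norm ?_)
    simpa only [hz, norm_mul_exp_pow] using h.hasSum.summable.abs
  have hsum2 : HasSum (fun j => q j - (u * ((q j : ℂ) * z ^ j)).re) 0 := by
    have h2 := h.hasSum.sub (Complex.hasSum_re (hsum.mul_left u))
    have h3 : u * circleGen q θ = 1 := by
      rw [hu, mul_comm, Complex.mul_conj, Complex.normSq_eq_norm_sq, h1]; simp
    rw [h3] at h2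
    simpa using h2
  have hre : ∀ j, (u * ((q j : ℂ) * z ^ j)).re = q j * (u * z ^ j).re := fun j => by
    rw [mul_left_comm, Complex.re_ofReal_mul]
  have hnorm : ∀ j, ‖u * z ^ j‖ = 1 := fun j => by rw [norm_mul, norm_pow, hun, hzn]; simp
  have hle : ∀ j, (u * z ^ j).re ≤ 1 := fun j => (Complex.re_le_norm _).trans (hnorm j).le
  have hzero : ∀ j, q j ≠ 0 → u * z ^ j = 1 := by
    intro j hj
    have h4 := (hasSum_zero_iff_of_nonneg (fun j => ?_)).1 hsum2
    · have h5 := congrFun h4 j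
      simp only [hre, Pi.zero_apply] at h5
      have h6 : (u * z ^ j).re = 1 := by
        have : q j * (1 - (u * z ^ j).re) = 0 := by linarith
        rcases mul_eq_zero.1 this with h | h
        · exact absurd h hj
        · linarith
      have h7 := hnorm j
      have h8 : (u * z ^ j).re ^ 2 + (u * z ^ j).im ^ 2 = 1 := by
        have := Complex.sq_norm (u * z ^ j)
        rw [h7, Complex.normSq_apply] at this
        nlinarith
      apply Complex.ext
      · simpa using h6
      · rw [h6] at h8
        simpa using h8
    · simp only [hre]
      nlinarith [h.nonneg j, hle j]
  have hu1 : u = 1 := by simpa using hzero 0 h.zero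
  intro j hj
  simpa [hu1] using hzero j hj

lemma exists_pos_variance (h : AperiodicLaw q) :
    ∃ v : ℝ, 0 < v ∧ HasSum (fun j : ℕ => q j * ((j : ℝ) - ∑' j : ℕ, (j : ℝ) * q j) ^ 2) v := by
  set m := ∑' j : ℕ, (j : ℝ) * q j
  have hs1 := summable_mul_of_summable_sq h.nonneg h.sq
  have hs : Summable (fun j : ℕ => q j * ((j : ℝ) - m) ^ 2) := by
    have := (h.sq.sub (hs1.mul_left (2 * m))).add (h.hasSum.summable.mul_left (m ^ 2))
    refine this.congr fun j => ?_
    ring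
  have hnn : ∀ j : ℕ, 0 ≤ q j * ((j : ℝ) - m) ^ 2 := fun j => mul_nonneg (h.nonneg j) (sq_nonneg _)
  have hex : ∃ j : ℕ, q j ≠ 0 ∧ (j : ℝ) ≠ m := by
    by_contra! hcon
    have h0 := hcon 0 h.zero
    have := h.aperiodic Real.pi fun j hj => by
      have : j = 0 := by
        have := hcon j hj
        rw [← h0] at this
        exact_mod_cast this
      simp [this]
    rw [Complex.exp_pi_mul_I] at this
    norm_num at this
  obtain ⟨j, hj, hjm⟩ := hex
  refine ⟨_, hs.tsum_pos hnn j ?_, hs.hasSum⟩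
  have := h.nonneg j
  have := sq_pos_of_ne_zero (sub_ne_zero.2 hjm)
  positivity

lemma centeredGen_eq_tsum (q : ℕ → ℝ) (θ : ℝ) :
    centeredGen q θ = ∑' j : ℕ, (q j : ℂ) *
      Complex.exp (((θ * (j - ∑' j : ℕ, (j : ℝ) * q j) : ℝ) : ℂ) * Complex.I) := by
  rw [centeredGen, circleGen, ← tsum_mul_right]
  congr 1
  ext j
  rw [mul_assoc, ← Complex.exp_nat_mul, ← Complex.exp_add]
  congr 2
  push_cast
  ring

lemma exists_charFun (h : AperiodicLaw q) :
    ∃ s : ℝ, 0 < s ∧ (fun t : ℝ => centeredGen q (s⁻¹ * t) - (1 - t ^ 2 / 2)) =o[𝓝 0]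
        (fun t => t ^ 2) ∧
      ∀ t : ℝ, Tendsto (fun n : ℕ => centeredGen q (s⁻¹ * ((√n)⁻¹ * t)) ^ n) atTop
        (𝓝 (Complex.exp (- t ^ 2 / 2))) := by
  obtain ⟨v, hv, hvs⟩ := h.exists_pos_variance
  set m := ∑' j : ℕ, (j : ℝ) * q j with hm
  set P : Measure ℕ := Measure.sum fun j => ENNReal.ofReal (q j) • Measure.dirac j with hP
  have : IsProbabilityMeasure P := h.hasSum.isProbabilityMeasure_sum_dirac h.nonneg
  set X : ℕ → ℝ := fun j => (√v)⁻¹ * (j - m) with hX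
  have hXm : AEMeasurable X P := Measurable.aemeasurable (by fun_prop)
  have h0 : ∫ j, X j ∂P = 0 := by
    rw [hP, integral_sum_dirac (by simp)]
    have : HasSum (fun j : ℕ => (√v)⁻¹ * ((j : ℝ) * q j - m * q j)) ((√v)⁻¹ * (m - m * 1)) :=
      ((summable_mul_of_summable_sq h.nonneg h.sq).hasSum.sub (h.hasSum.mul_left m)).mul_left _
    rw [← (by ring : (√v)⁻¹ * (m - m * 1) = 0), ← this.tsum_eq]
    congr 1; ext j
    rw [ENNReal.toReal_ofReal (h.nonneg j), hX]
    simp only [smul_eq_mul]; ring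
  have h1 : ∫ j, (X ^ 2) j ∂P = 1 := by
    rw [hP, integral_sum_dirac (by simp)]
    have := hvs.mul_left v⁻¹
    rw [inv_mul_cancel₀ hv.ne'] at this
    rw [← this.tsum_eq]
    congr 1; ext j
    rw [ENNReal.toReal_ofReal (h.nonneg j), hX]
    simp only [smul_eq_mul, Pi.pow_apply, mul_pow, inv_pow, Real.sq_sqrt hv.le]; ring
  have hchar : ∀ t, charFun (P.map X) t = centeredGen q ((√v)⁻¹ * t) := by
    intro t
    rw [charFun_apply_real, integral_map hXm (by fun_prop), hP, integral_sum_dirac (by simp),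
      centeredGen_eq_tsum]
    congr 1; ext j
    rw [ENNReal.toReal_ofReal (h.nonneg j), hX, Complex.real_smul]
    congr 2
    rw [← hm]
    push_cast
    ring
  refine ⟨√v, Real.sqrt_pos.2 hv, ?_, fun t => ?_⟩
  · have := taylor_charFun_two hXm h0 h1
    simpa only [hchar] using this
  · have := ProbabilityTheory.tendsto_charFun_inv_sqrt_mul_pow hXm h0 h1 t
    simpa only [hchar] using this

end AperiodicLaw

namespace AperiodicLaw

variable {q : ℕ → ℝ}

lemma exists_norm_circleGen_le (h : AperiodicLaw q) :
    ∃ c : ℝ, 0 < c ∧ ∀ θ : ℝ, |θ| ≤ Real.pi → ‖circleGen q θ‖ ≤ Real.exp (-c * θ ^ 2) := by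
  obtain ⟨s, hs, hT, -⟩ := h.exists_charFun
  have h1 := hT.def (by norm_num : (0 : ℝ) < 1 / 4)
  obtain ⟨δ, hδ, h2⟩ := Metric.eventually_nhds_iff.1 h1
  set δ' := min (min δ 1 / s) Real.pi with hδ'
  have hδ'0 : 0 < δ' := lt_min (by positivity) Real.pi_pos
  have hnear : ∀ θ : ℝ, |θ| < δ' → ‖circleGen q θ‖ ≤ Real.exp (-(s ^ 2 / 4) * θ ^ 2) := by
    intro θ hθ
    have h3 : |s * θ| < min δ 1 := by
      rw [abs_mul, abs_of_pos hs, mul_comm, ← lt_div_iff₀ hs]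
      exact hθ.trans_le (min_le_left _ _)
    have h4 := h2 (y := s * θ) (by
      rw [Real.dist_eq, sub_zero]; exact h3.trans_le (min_le_left _ _))
    rw [inv_mul_cancel_left₀ hs.ne'] at h4
    have h5 : (s * θ) ^ 2 ≤ 1 := by
      rw [← sq_abs]
      have := h3.trans_le (min_le_right _ _)
      nlinarith [abs_nonneg (s * θ)]
    have h6 : ‖((1 : ℂ) - ((s * θ : ℝ) : ℂ) ^ 2 / 2)‖ = 1 - (s * θ) ^ 2 / 2 := by
      have : ((1 : ℂ) - ((s * θ : ℝ) : ℂ) ^ 2 / 2) = ((1 - (s * θ) ^ 2 / 2 : ℝ) : ℂ) := by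
        push_cast; ring
      rw [this, Complex.norm_real, Real.norm_of_nonneg (by linarith)]
    have h7 := norm_le_norm_add_norm_sub' (centeredGen q θ)
      ((1 : ℂ) - ((s * θ : ℝ) : ℂ) ^ 2 / 2)
    rw [Real.norm_of_nonneg (sq_nonneg (s * θ))] at h4
    rw [h6, norm_centeredGen] at h7
    have h8 := Real.add_one_le_exp (-(s ^ 2 / 4) * θ ^ 2)
    nlinarith
  have hK : IsCompact (Set.Icc (-Real.pi) Real.pi ∩ {θ : ℝ | δ' ≤ |θ|}) :=
    isCompact_Icc.inter_right (isClosed_le continuous_const continuous_abs)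
  obtain ⟨θ₀, hθ₀, hmax⟩ := hK.exists_isMaxOn
    ⟨Real.pi, ⟨by linarith [Real.pi_pos], le_rfl⟩, by
      simp only [Set.mem_ofPred_eq, abs_of_pos Real.pi_pos]; exact min_le_right _ _⟩
    (continuous_circleGen h.hasSum.summable).norm.continuousOn
  set M := max ‖circleGen q θ₀‖ (1 / 2) with hM
  have hM0 : 0 < M := by positivity
  have hM1 : M < 1 := by
    refine max_lt (h.norm_circleGen_lt_one fun hexp => ?_) (by norm_num)
    have h0 : θ₀ ≠ 0 := by
      rintro rfl
      have := hθ₀.2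
      simp only [Set.mem_ofPred_eq, abs_zero] at this
      linarith
    obtain ⟨k, hk⟩ := Complex.exp_eq_one_iff.1 hexp
    have hk' : θ₀ = k * (2 * Real.pi) := by
      have : (θ₀ : ℂ) = k * (2 * Real.pi) := by
        apply mul_right_cancel₀ Complex.I_ne_zero
        rw [hk]; ring
      exact_mod_cast this
    have hk0 : k ≠ 0 := by rintro rfl; simp at hk'; exact h0 hk'
    have : (1 : ℝ) ≤ |(k : ℝ)| := by exact_mod_cast Int.one_le_abs hk0
    have h9 : |θ₀| ≤ Real.pi := abs_le.2 hθ₀.1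
    rw [hk', abs_mul, abs_of_pos (by positivity : 0 < 2 * Real.pi)] at h9
    nlinarith [Real.pi_pos]
  have hlog : 0 < -Real.log M := by linarith [Real.log_neg hM0 hM1]
  refine ⟨min (s ^ 2 / 4) (-Real.log M / Real.pi ^ 2), lt_min (by positivity) (by positivity),
    fun θ hθ => ?_⟩
  rcases lt_or_ge |θ| δ' with h9 | h9
  · refine (hnear θ h9).trans (Real.exp_le_exp.2 ?_)
    have := min_le_left (s ^ 2 / 4) (-Real.log M / Real.pi ^ 2)
    nlinarith [sq_nonneg θ]
  · have h10 : ‖circleGen q θ‖ ≤ M := (hmax ⟨abs_le.1 hθ, h9⟩).trans (le_max_left _ _)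
    refine h10.trans ?_
    rw [← Real.exp_log hM0, Real.log_exp]
    refine Real.exp_le_exp.2 ?_
    have h11 := min_le_right (s ^ 2 / 4) (-Real.log M / Real.pi ^ 2)
    have h12 : θ ^ 2 ≤ Real.pi ^ 2 := by
      rw [← sq_abs]; exact pow_le_pow_left₀ (abs_nonneg _) hθ 2
    have h13 : -Real.log M / Real.pi ^ 2 * θ ^ 2 ≤ -Real.log M := by
      rw [div_mul_eq_mul_div, div_le_iff₀ (by positivity)]
      exact mul_le_mul_of_nonneg_left h12 hlog.le
    nlinarith [sq_nonneg θ]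

lemma exists_coeff_pow_le (h : AperiodicLaw q) :
    ∃ C : ℝ, 0 < C ∧ ∀ n N : ℕ, 1 ≤ n → (PowerSeries.mk q ^ n).coeff N ≤ C / √n := by
  obtain ⟨c, hc, hb⟩ := h.exists_norm_circleGen_le
  refine ⟨√(Real.pi / c), by positivity, fun n N hn => ?_⟩
  have hn0 : (0 : ℝ) < n := by exact_mod_cast hn
  have h1 := integral_circleGen_pow h.hasSum.summable n N
  have hint : Integrable fun θ : ℝ => Real.exp (-(c * n) * θ ^ 2) :=
    integrable_exp_neg_mul_sq (by positivity)
  have h2 : ‖∫ θ in (-Real.pi)..Real.pi, circleGen q θ ^ n * Complex.exp (-(N * θ * Complex.I))‖ ≤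
      ∫ θ in (-Real.pi)..Real.pi, Real.exp (-(c * n) * θ ^ 2) := by
    refine intervalIntegral.norm_integral_le_of_norm_le (by linarith [Real.pi_pos])
      (ae_of_all _ fun θ hθ => ?_) hint.intervalIntegrable
    have : -((N : ℂ) * θ * Complex.I) = ((-(N * θ) : ℝ) : ℂ) * Complex.I := by push_cast; ring
    rw [norm_mul, this, Complex.norm_exp_ofReal_mul_I, mul_one, norm_pow]
    refine (pow_le_pow_left₀ (norm_nonneg _) (hb θ (abs_le.2 ⟨hθ.1.le, hθ.2⟩)) n).trans ?_
    rw [← Real.exp_nat_mul]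
    refine Real.exp_le_exp.2 (le_of_eq ?_)
    ring
  have h3 : ∫ θ in (-Real.pi)..Real.pi, Real.exp (-(c * n) * θ ^ 2) ≤ √(Real.pi / (c * n)) := by
    rw [← integral_gaussian, intervalIntegral.integral_of_le (by linarith [Real.pi_pos])]
    exact setIntegral_le_integral hint (ae_of_all _ fun θ => (Real.exp_pos _).le)
  rw [h1] at h2
  have h4 : ‖2 * (Real.pi : ℂ) * ((PowerSeries.mk q ^ n).coeff N : ℝ)‖ =
      2 * Real.pi * (PowerSeries.mk q ^ n).coeff N := by
    rw [norm_mul, norm_mul, Complex.norm_real, Complex.norm_real,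
      Real.norm_of_nonneg (coeff_mk_pow_nonneg h.nonneg n N), Real.norm_of_nonneg Real.pi_pos.le]
    simp
  rw [h4] at h2
  have h5 : √(Real.pi / (c * n)) = √(Real.pi / c) / √n := by
    rw [← div_div, Real.sqrt_div (by positivity)]
  rw [h5] at h3
  have h6 := coeff_mk_pow_nonneg h.nonneg n N
  nlinarith [Real.pi_gt_three]

lemma tendsto_integral_centeredGen (h : AperiodicLaw q) :
    ∃ s : ℝ, 0 < s ∧ Tendsto (fun n : ℕ => ((s * √n : ℝ) : ℂ) *
      ∫ θ in (-Real.pi)..Real.pi, centeredGen q θ ^ n *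
        Complex.exp ((((∑' j : ℕ, (j : ℝ) * q j) * θ : ℝ) : ℂ) * Complex.I)) atTop
      (𝓝 ((√(2 * Real.pi) : ℝ) : ℂ)) := by
  obtain ⟨s, hs, -, hlim⟩ := h.exists_charFun
  obtain ⟨c, hc, hb⟩ := h.exists_norm_circleGen_le
  refine ⟨s, hs, ?_⟩
  set m := ∑' j : ℕ, (j : ℝ) * q j with hm
  set G : ℕ → ℝ → ℂ := fun n θ => centeredGen q θ ^ n * Complex.exp (((m * θ : ℝ) : ℂ) * Complex.I)
    with hG
  have hcont : ∀ n, Continuous (G n) := fun n => by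
    have := h.continuous_centeredGen
    simp only [hG]; fun_prop
  have hbound : ∀ n θ, ‖G n θ‖ = ‖circleGen q θ‖ ^ n := fun n θ => by
    simp only [hG]
    rw [norm_mul, Complex.norm_exp_ofReal_mul_I, mul_one, norm_pow, norm_centeredGen]
  set F : ℕ → ℝ → ℂ := fun n => Set.indicator (Set.Ioc (-(Real.pi * (s * √n))) (Real.pi * (s * √n)))
    fun u => G n ((s * √n)⁻¹ * u) with hF
  have hFint : ∀ᶠ n : ℕ in atTop, ∫ u, F n u =
      ((s * √n : ℝ) : ℂ) * ∫ θ in (-Real.pi)..Real.pi, G n θ := by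
    filter_upwards [eventually_ge_atTop 1] with n hn
    have hn0 : (0 : ℝ) < n := by exact_mod_cast hn
    have hk : 0 < s * √n := by positivity
    rw [hF, integral_indicator measurableSet_Ioc, ← intervalIntegral.integral_of_le
      (by nlinarith [Real.pi_pos]), intervalIntegral.integral_comp_mul_left _ (inv_ne_zero hk.ne'),
      inv_inv, Complex.real_smul]
    congr 2 <;> field_simp
  refine Tendsto.congr' hFint ?_
  have hgauss : ((√(2 * Real.pi) : ℝ) : ℂ) = ∫ u : ℝ, Complex.exp (-(u : ℂ) ^ 2 / 2) := by
    have h1 : √(2 * Real.pi) = ∫ u : ℝ, Real.exp (-(1 / 2) * u ^ 2) := by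
      rw [integral_gaussian]; congr 1; ring
    rw [h1, ← integral_complex_ofReal]
    congr 1; ext u
    push_cast
    congr 1; ring
  rw [hgauss]
  refine tendsto_integral_of_dominated_convergence (fun u => Real.exp (-(c / s ^ 2) * u ^ 2))
    (fun n => ?_) (integrable_exp_neg_mul_sq (by positivity)) (fun n => ae_of_all _ fun u => ?_)
    (ae_of_all _ fun u => ?_)
  · exact (((hcont n).comp (continuous_const.mul continuous_id)).aestronglyMeasurable).indicator
      measurableSet_Ioc
  · simp only [hF]
    by_cases hu : u ∈ Set.Ioc (-(Real.pi * (s * √n))) (Real.pi * (s * √n))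
    · rw [Set.indicator_of_mem hu]
      have hk : 0 < s * √n := by
        have := hu.1.trans_le hu.2
        by_contra! hcon
        nlinarith [Real.pi_pos]
      rw [hbound]
      have hθ : |(s * √n)⁻¹ * u| ≤ Real.pi := by
        rw [abs_mul, abs_of_pos (inv_pos.2 hk), inv_mul_le_iff₀ hk, mul_comm]
        exact abs_le.2 ⟨hu.1.le, hu.2⟩
      refine (pow_le_pow_left₀ (norm_nonneg _) (hb _ hθ) n).trans ?_
      rw [← Real.exp_nat_mul]
      refine Real.exp_le_exp.2 (le_of_eq ?_)
      have hn : (√n) ^ 2 = n := Real.sq_sqrt (Nat.cast_nonneg n)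
      have hn0 : (n : ℝ) ≠ 0 := by
        intro h0
        simp [h0] at hk
      rw [mul_pow, inv_pow, mul_pow, hn]
      field_simp
    · rw [Set.indicator_of_notMem hu]; simpa using (Real.exp_pos _).le
  · have hsq : Tendsto (fun n : ℕ => √(n : ℝ)) atTop atTop :=
      Real.tendsto_sqrt_atTop.comp tendsto_natCast_atTop_atTop
    have h1 : Tendsto (fun n : ℕ => Real.pi * (s * √n)) atTop atTop :=
      (hsq.const_mul_atTop hs).const_mul_atTop Real.pi_pos
    have h2 : ∀ᶠ n : ℕ in atTop, G n ((s * √n)⁻¹ * u) = F n u := by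
      filter_upwards [h1.eventually_gt_atTop |u|] with n hn
      simp only [hF]
      rw [Set.indicator_of_mem]
      have := abs_lt.1 hn
      exact ⟨this.1, this.2.le⟩
    refine Tendsto.congr' h2 ?_
    rw [← mul_one (Complex.exp (-(u : ℂ) ^ 2 / 2))]
    refine Tendsto.mul ?_ ?_
    · refine (hlim u).congr fun n => ?_
      rw [mul_inv, mul_assoc]
    · have h3 : Tendsto (fun n : ℕ => (s * √n)⁻¹ * u) atTop (𝓝 0) := by
        have := (tendsto_inv_atTop_zero.comp (hsq.const_mul_atTop hs)).mul_const u
        simpa using this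
      have h4 : Continuous fun θ : ℝ => Complex.exp (((m * θ : ℝ) : ℂ) * Complex.I) := by fun_prop
      have h5 := (h4.tendsto 0).comp h3
      simpa [Function.comp_def] using h5

lemma exists_le_coeff_pow (h : AperiodicLaw q) :
    ∃ c : ℝ, 0 < c ∧ ∃ n₀ : ℕ, ∀ n N : ℕ, n₀ ≤ n →
      (N : ℝ) = (∑' j : ℕ, (j : ℝ) * q j) * (n - 1) →
      c / √n ≤ (PowerSeries.mk q ^ n).coeff N := by
  obtain ⟨s, hs, hlim⟩ := h.tendsto_integral_centeredGen
  set m := ∑' j : ℕ, (j : ℝ) * q j with hm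
  have h1 := hlim.norm
  have h2 : (1 : ℝ) < ‖((√(2 * Real.pi) : ℝ) : ℂ)‖ := by
    rw [Complex.norm_real, Real.norm_of_nonneg (Real.sqrt_nonneg _)]
    rw [Real.lt_sqrt zero_le_one]
    nlinarith [Real.pi_gt_three]
  obtain ⟨n₀, hn₀⟩ := eventually_atTop.1 (h1.eventually_const_lt h2)
  refine ⟨1 / (2 * Real.pi * s), by positivity, max n₀ 1, fun n N hn hN => ?_⟩
  have h3 := hn₀ n (le_of_max_le_left hn)
  have hn0 : (0 : ℝ) < n := by exact_mod_cast le_of_max_le_right hn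
  have h4 : ∀ θ : ℝ, centeredGen q θ ^ n * Complex.exp (((m * θ : ℝ) : ℂ) * Complex.I) =
      circleGen q θ ^ n * Complex.exp (-(N * θ * Complex.I)) := by
    intro θ
    rw [centeredGen, mul_pow, mul_assoc, ← Complex.exp_nat_mul, ← Complex.exp_add, ← hm]
    congr 2
    have : (N : ℂ) = m * (n - 1) := by exact_mod_cast congrArg (fun x : ℝ => (x : ℂ)) hN
    rw [this]
    push_cast
    ring
  simp only [h4] at h3
  rw [integral_circleGen_pow h.hasSum.summable, norm_mul, norm_mul, norm_mul, Complex.norm_real,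
    Complex.norm_real, Complex.norm_real, Real.norm_of_nonneg (coeff_mk_pow_nonneg h.nonneg n N),
    Real.norm_of_nonneg Real.pi_pos.le, Real.norm_of_nonneg (by positivity)] at h3
  rw [div_div, div_le_iff₀ (by positivity)]
  simp only [Complex.norm_ofNat] at h3
  nlinarith

end AperiodicLaw

section OffspringLaw

variable {p : ℕ → ℝ}

lemma offspring_zero_ne_zero (hp : ∀ i, 0 ≤ p i) (hsum : HasSum p 1)
    (hmean : HasSum (fun i : ℕ => (i : ℝ) * p i) 1) (hvar : 1 < ∑' i : ℕ, (i : ℝ) ^ 2 * p i) :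
    p 0 ≠ 0 := by
  intro h0
  have h1 : HasSum (fun i : ℕ => (i : ℝ) * p i - p i) 0 := by simpa using hmean.sub hsum
  have h2 := (hasSum_zero_iff_of_nonneg (fun i => by
    rcases Nat.eq_zero_or_pos i with rfl | hi
    · simp [h0]
    · have : (1 : ℝ) ≤ i := by exact_mod_cast hi
      nlinarith [hp i])).1 h1
  have h3 : ∀ i : ℕ, (i : ℝ) ^ 2 * p i = i * p i := fun i => by
    have := congrFun h2 i
    simp only [Pi.zero_apply] at this
    have h4 : (i : ℝ) * p i = p i := by linarith
    rw [sq, mul_assoc, h4, h4]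
  simp only [h3, hmean.tsum_eq] at hvar
  exact lt_irrefl _ hvar

lemma exists_span_support (hmean : HasSum (fun i : ℕ => (i : ℝ) * p i) 1) :
    ∃ h : ℕ, h ≠ 0 ∧ (∀ i, p i ≠ 0 → h ∣ i) ∧
      (h : ℤ) ∈ AddSubgroup.closure {z : ℤ | ∃ i : ℕ, p i ≠ 0 ∧ z = i} := by
  obtain ⟨g, hg⟩ := Int.subgroup_cyclic (AddSubgroup.closure {z : ℤ | ∃ i : ℕ, p i ≠ 0 ∧ z = i})
  have hdvd : ∀ i, p i ≠ 0 → g.natAbs ∣ i := by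
    intro i hi
    have : (i : ℤ) ∈ AddSubgroup.closure {z : ℤ | ∃ i : ℕ, p i ≠ 0 ∧ z = i} :=
      AddSubgroup.subset_closure ⟨i, hi, rfl⟩
    rw [hg, ← AddSubgroup.zmultiples_eq_closure, Int.mem_zmultiples_iff] at this
    exact Int.natCast_dvd_natCast.1 (by simpa using this)
  refine ⟨g.natAbs, fun h0 => ?_, hdvd, ?_⟩
  · have : ∀ i : ℕ, (i : ℝ) * p i = 0 := fun i => by
      by_cases hi : p i = 0
      · simp [hi]
      · have := hdvd i hi
        rw [h0, zero_dvd_iff] at this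
        simp [this]
    simp only [this] at hmean
    exact zero_ne_one (hasSum_zero.unique hmean)
  · rw [hg, ← AddSubgroup.zmultiples_eq_closure, Int.mem_zmultiples_iff]
    simp

/-- The law of `ξ / h` when `ξ` has law `p` and `h` is the span of `p`. -/
lemma aperiodicLaw_comp_mul (hp : ∀ i, 0 ≤ p i) (hsum : HasSum p 1)
    (hsq : Summable fun i : ℕ => (i : ℝ) ^ 2 * p i) (h0 : p 0 ≠ 0) {h : ℕ} (hh : h ≠ 0)
    (hdvd : ∀ i, p i ≠ 0 → h ∣ i)
    (hmem : (h : ℤ) ∈ AddSubgroup.closure {z : ℤ | ∃ i : ℕ, p i ≠ 0 ∧ z = i}) :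
    AperiodicLaw fun j => p (h * j) := by
  have hinj : Function.Injective fun j : ℕ => h * j := fun a b hab => by
    simpa [hh] using hab
  refine ⟨fun j => hp _, ?_, ?_, by simpa using h0, fun θ hθ => ?_⟩
  · refine (hinj.hasSum_iff fun i hi => ?_).2 hsum
    by_contra hpi
    obtain ⟨j, rfl⟩ := hdvd i hpi
    exact hi ⟨j, rfl⟩
  · have := (hsq.comp_injective hinj).mul_left ((h : ℝ)⁻¹ ^ 2)
    refine this.congr fun j => ?_
    have : (h : ℝ) ≠ 0 := by exact_mod_cast hh
    simp only [Function.comp_apply]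
    push_cast
    field_simp
  · have key : ∀ z ∈ AddSubgroup.closure {z : ℤ | ∃ i : ℕ, p i ≠ 0 ∧ z = i},
        ∃ w : ℤ, z = h * w ∧ Complex.exp (θ * Complex.I) ^ w = 1 := by
      intro z hz
      induction hz using AddSubgroup.closure_induction with
      | mem z hz =>
        obtain ⟨i, hi, rfl⟩ := hz
        obtain ⟨j, rfl⟩ := hdvd i hi
        exact ⟨j, by push_cast; rfl, by simpa using hθ j hi⟩
      | zero => exact ⟨0, by simp, by simp⟩
      | add a b _ _ ha hb =>
        obtain ⟨u, rfl, hu⟩ := ha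
        obtain ⟨v, rfl, hv⟩ := hb
        exact ⟨u + v, by ring, by rw [zpow_add₀ (Complex.exp_ne_zero _), hu, hv, one_mul]⟩
      | neg a _ ha =>
        obtain ⟨u, rfl, hu⟩ := ha
        exact ⟨-u, by ring, by rw [zpow_neg, hu, inv_one]⟩
    obtain ⟨w, hw, hw1⟩ := key h hmem
    have : w = 1 := by
      have hh' : (h : ℤ) ≠ 0 := by exact_mod_cast hh
      exact mul_left_cancel₀ hh' (by rw [← hw, mul_one])
    simpa [this] using hw1

lemma coeff_mk_pow_of_span {h : ℕ} (hh : h ≠ 0) (hdvd : ∀ i, p i ≠ 0 → h ∣ i) (n N : ℕ) :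
    (PowerSeries.mk p ^ n).coeff N =
      if h ∣ N then (PowerSeries.mk (fun j => p (h * j)) ^ n).coeff (N / h) else 0 := by
  have h1 : PowerSeries.mk p = (PowerSeries.mk fun j => p (h * j)).expand h hh := by
    ext i
    rw [PowerSeries.coeff_expand, PowerSeries.coeff_mk]
    split_ifs with hi
    · rw [PowerSeries.coeff_mk, Nat.mul_div_cancel' hi]
    · by_contra hpi
      exact hi (hdvd i hpi)
  rw [h1, ← map_pow, PowerSeries.coeff_expand]

/-- Local limit bounds for sums of i.i.d. critical offspring numbers. -/
theorem exists_bounds_coeff_mk_pow (hp : ∀ i, 0 ≤ p i) (hsum : HasSum p 1)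
    (hmean : HasSum (fun i : ℕ => (i : ℝ) * p i) 1)
    (hsq : Summable fun i : ℕ => (i : ℝ) ^ 2 * p i) (hvar : 1 < ∑' i : ℕ, (i : ℝ) ^ 2 * p i) :
    (∃ C : ℝ, 0 < C ∧ ∀ n N : ℕ, 1 ≤ n → (PowerSeries.mk p ^ n).coeff N ≤ C / √n) ∧
    (∃ c : ℝ, 0 < c ∧ ∃ n₀ : ℕ, ∀ n : ℕ, n₀ ≤ n → (PowerSeries.mk p ^ (n + 1)).coeff n ≠ 0 →
      c / √(n + 1 : ℕ) ≤ (PowerSeries.mk p ^ (n + 1)).coeff n) := by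
  have h0 := offspring_zero_ne_zero hp hsum hmean hvar
  obtain ⟨h, hh, hdvd, hmem⟩ := exists_span_support hmean
  have hA := aperiodicLaw_comp_mul hp hsum hsq h0 hh hdvd hmem
  have hh0 : (h : ℝ) ≠ 0 := by exact_mod_cast hh
  have hinj : Function.Injective fun j : ℕ => h * j := fun a b hab => by
    simpa [hh] using hab
  have hmq : ∑' j : ℕ, (j : ℝ) * p (h * j) = (h : ℝ)⁻¹ := by
    have h1 : HasSum ((fun i : ℕ => (i : ℝ) * p i) ∘ fun j => h * j) 1 := by
      refine (hinj.hasSum_iff fun i hi => ?_).2 hmean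
      by_contra hpi
      obtain ⟨j, rfl⟩ := hdvd i (right_ne_zero_of_mul hpi)
      exact hi ⟨j, rfl⟩
    have h2 := (h1.mul_left (h : ℝ)⁻¹).tsum_eq
    rw [mul_one] at h2
    rw [← h2]
    congr 1; ext j
    simp only [Function.comp_apply]
    push_cast
    field_simp
  constructor
  · obtain ⟨C, hC, hb⟩ := hA.exists_coeff_pow_le
    refine ⟨C, hC, fun n N hn => ?_⟩
    rw [coeff_mk_pow_of_span hh hdvd]
    split_ifs
    · exact hb n _ hn
    · positivity
  · obtain ⟨c, hc, n₀, hb⟩ := hA.exists_le_coeff_pow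
    refine ⟨c, hc, n₀, fun n hn hne => ?_⟩
    rw [coeff_mk_pow_of_span hh hdvd] at hne ⊢
    split_ifs at hne ⊢ with hd
    · refine hb (n + 1) _ (by omega) ?_
      rw [hmq]
      obtain ⟨j, rfl⟩ := hd
      rw [Nat.mul_div_cancel_left _ (Nat.pos_of_ne_zero hh)]
      push_cast
      field_simp
      ring
    · exact absurd rfl hne

end OffspringLaw

end LocalLimit

section Trees

namespace PTree

theorem size_node (ts : List PTree) : (node ts).size = 1 + (ts.map size).sum := by
  rw [size, List.attach_map_val]

theorem weight_node (p : ℕ → ℝ) (ts : List PTree) :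
    weight p (node ts) = p ts.length * (ts.map (weight p)).prod := by
  rw [weight, List.attach_map_val]

theorem size_pos (T : PTree) : 0 < T.size := by
  cases T with
  | node ts => rw [size_node]; omega

theorem weight_nonneg {p : ℕ → ℝ} (hp : ∀ i, 0 ≤ p i) : ∀ T : PTree, 0 ≤ weight p T
  | node ts => by
    rw [weight_node]
    refine mul_nonneg (hp _) (List.prod_nonneg ?_)
    intro a ha
    obtain ⟨T, hT, rfl⟩ := List.mem_map.1 ha
    exact weight_nonneg hp T
decreasing_by
  have := List.sizeOf_lt_of_mem hT
  simp only [node.sizeOf_spec]; omega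

theorem finite_size_le (n : ℕ) : {T : PTree | T.size ≤ n}.Finite := by
  induction n with
  | zero =>
    refine Set.Finite.subset Set.finite_empty fun T hT => ?_
    exact absurd (size_pos T) (by simpa using hT)
  | succ n ih =>
    have : Finite {T : PTree | T.size ≤ n} := ih
    refine Set.Finite.subset (Set.finite_iUnion fun d : Fin (n + 1) =>
      Set.finite_range fun f : Fin d → {T : PTree | T.size ≤ n} =>
        node (List.ofFn fun i => (f i).1)) ?_
    rintro ⟨ts⟩ hT
    have hT' : 1 + (ts.map size).sum ≤ n + 1 := by rw [← size_node]; exact hT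
    have hlen : ts.length ≤ (ts.map size).sum := by
      have := List.card_nsmul_le_sum (ts.map size) 1 (fun x hx => by
        obtain ⟨T, -, rfl⟩ := List.mem_map.1 hx
        exact size_pos T)
      simpa using this
    refine Set.mem_iUnion.2 ⟨⟨ts.length, by omega⟩, ⟨fun i => ⟨ts.get i, ?_⟩, ?_⟩⟩
    · have : size (ts.get i) ≤ (ts.map size).sum :=
        List.single_le_sum (fun _ _ => Nat.zero_le _) _
          (List.mem_map.2 ⟨_, List.get_mem ts i, rfl⟩)
      change size (ts.get i) ≤ n
      omega
    · simp only [List.ofFn_get]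

theorem finite_size_eq (n : ℕ) : {T : PTree | T.size = n}.Finite :=
  (finite_size_le n).subset fun _ h => Nat.le_of_eq h

/-- The finite set of all trees with `n` nodes. -/
noncomputable def ofSize (n : ℕ) : Finset PTree :=
  (finite_size_eq n).toFinset

theorem mem_ofSize {n : ℕ} {T : PTree} : T ∈ ofSize n ↔ T.size = n := by
  simp [ofSize]

theorem treeSum_eq_sum (p : ℕ → ℝ) (n : ℕ) : treeSum p n = ∑ T ∈ ofSize n, weight p T := by
  rw [treeSum, ← Finset.tsum_subtype]
  exact (Equiv.subtypeEquivRight fun T => mem_ofSize.symm).tsum_eq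
    (fun T : {T // T ∈ ofSize n} => weight p T.1)

open Classical in
theorem condProb_eq_sum (p : ℕ → ℝ) (n : ℕ) (A : PTree → Prop) :
    condProb p n A = (∑ T ∈ ofSize n, weight p T * if A T then 1 else 0) / treeSum p n := by
  have h : (∑ T ∈ ofSize n, weight p T * if A T then 1 else 0) =
      ∑ T ∈ (ofSize n).filter A, weight p T := by
    rw [Finset.sum_filter]; exact Finset.sum_congr rfl fun T _ => by split_ifs <;> simp
  rw [condProb, h, ← Finset.tsum_subtype]
  congr 1
  exact (Equiv.subtypeEquivRight fun T => by rw [Finset.mem_filter, mem_ofSize]).tsum_eq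
    (fun T : {T // T ∈ (ofSize n).filter A} => weight p T.1)

theorem condExp_eq_sum (p : ℕ → ℝ) (n : ℕ) (f : PTree → ℝ) :
    condExp p n f = (∑ T ∈ ofSize n, weight p T * f T) / treeSum p n := by
  rw [condExp, ← Finset.tsum_subtype]
  congr 1
  exact (Equiv.subtypeEquivRight fun T => mem_ofSize.symm).tsum_eq
    (fun T : {T // T ∈ ofSize n} => weight p T.1 * f T.1)

theorem sum_ofSize_succ (p : ℕ → ℝ) (N : ℕ) (φ : List ℕ → ℝ) :
    ∑ T ∈ ofSize (N + 1), weight p T * φ T.childSizes =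
      ∑ d ∈ Finset.range (N + 1), p d *
        ∑ x ∈ Finset.piAntidiag (Finset.univ : Finset (Fin d)) N,
          (∏ i, treeSum p (x i)) * φ (List.ofFn x) := by
  simp_rw [treeSum_eq_sum, Finset.prod_univ_sum, Finset.mul_sum, Finset.sum_mul, Finset.mul_sum]
  simp_rw [Finset.sum_sigma']
  symm
  refine Finset.sum_bij (fun y _ => node (List.ofFn y.2.2)) ?_ ?_ ?_ ?_
  · rintro ⟨d, x, f⟩ h
    simp only [Finset.mem_sigma, Finset.mem_range, Finset.mem_piAntidiag, Fintype.mem_piFinset,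
      mem_ofSize] at h
    rw [mem_ofSize, size_node, List.map_ofFn, List.sum_ofFn]
    simp only [Function.comp_apply, h.2.2]
    have hx : ∑ i, x i = N := h.2.1.1
    omega
  · rintro ⟨d, x, f⟩ h ⟨d', x', f'⟩ h' heq
    simp only [Finset.mem_sigma, Finset.mem_range, Finset.mem_piAntidiag, Fintype.mem_piFinset,
      mem_ofSize] at h h'
    simp only [node.injEq] at heq
    obtain rfl : d = d' := by simpa using congrArg List.length heq
    obtain rfl := List.ofFn_injective heq
    obtain rfl : x = x' := funext fun i => (h.2.2 i).symm.trans (h'.2.2 i)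
    rfl
  · rintro ⟨ts⟩ h
    rw [mem_ofSize, size_node] at h
    have hlen : ts.length ≤ (ts.map size).sum := by
      have := List.card_nsmul_le_sum (ts.map size) 1 (fun x hx => by
        obtain ⟨T, -, rfl⟩ := List.mem_map.1 hx
        exact size_pos T)
      simpa using this
    refine ⟨⟨ts.length, fun i => size (ts.get i), ts.get⟩, ?_, by simp only [List.ofFn_get]⟩
    simp only [Finset.mem_sigma, Finset.mem_range, Finset.mem_piAntidiag, Fintype.mem_piFinset,
      mem_ofSize]
    refine ⟨by omega, ⟨?_, by simp⟩, fun _ => trivial⟩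
    rw [← List.sum_ofFn, show (fun i => size (ts.get i)) = size ∘ ts.get from rfl,
      ← List.map_ofFn, List.ofFn_get]
    omega
  · rintro ⟨d, x, f⟩ h
    simp only [Finset.mem_sigma, Finset.mem_range, Finset.mem_piAntidiag, Fintype.mem_piFinset,
      mem_ofSize] at h
    have : size ∘ f = x := funext h.2.2
    simp only [weight_node, childSizes, List.length_ofFn, List.map_ofFn, List.prod_ofFn, this,
      Function.comp_apply]
    ring

end PTree

end Trees

section TreeSeries

open Finset.HasAntidiagonal

theorem coeff_prod_eq_sum_piAntidiag {ι : Type*} [DecidableEq ι] (f : ι → PowerSeries ℝ)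
    (N : ℕ) (s : Finset ι) :
    (∏ i ∈ s, f i).coeff N =
      ∑ x ∈ Finset.piAntidiag s N, ∏ i ∈ s, (f i).coeff (x i) := by
  rw [PowerSeries.coeff_prod]
  refine Finset.sum_bij (fun l _ => l) ?_ ?_ ?_ ?_
  · intro l hl
    rw [Finset.mem_finsuppAntidiag] at hl
    rw [Finset.mem_piAntidiag]
    exact ⟨hl.1, fun i hi => hl.2 (Finsupp.mem_support_iff.2 hi)⟩
  · intro l _ l' _ h
    exact DFunLike.coe_injective h
  · intro x hx
    rw [Finset.mem_piAntidiag] at hx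
    refine ⟨Finsupp.onFinset s x hx.2, ?_, rfl⟩
    rw [Finset.mem_finsuppAntidiag]
    exact ⟨hx.1, Finsupp.support_onFinset_subset⟩
  · intro l _
    rfl

theorem treeSum_nonneg {p : ℕ → ℝ} (hp : ∀ i, 0 ≤ p i) (n : ℕ) : 0 ≤ treeSum p n := by
  rw [PTree.treeSum_eq_sum]
  exact Finset.sum_nonneg fun T _ => T.weight_nonneg hp

theorem treeSum_zero (p : ℕ → ℝ) : treeSum p 0 = 0 := by
  rw [PTree.treeSum_eq_sum]
  refine Finset.sum_eq_zero fun T hT => ?_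
  exact absurd T.size_pos (by simp [PTree.mem_ofSize.1 hT])

theorem treeSum_succ (p : ℕ → ℝ) (N : ℕ) :
    treeSum p (N + 1) = ∑ d ∈ Finset.range (N + 1),
      p d * (PowerSeries.mk (treeSum p) ^ d).coeff N := by
  have h := PTree.sum_ofSize_succ p N fun _ => 1
  simp only [mul_one] at h
  rw [PTree.treeSum_eq_sum, h]
  refine Finset.sum_congr rfl fun d _ => ?_
  have := coeff_prod_eq_sum_piAntidiag (fun _ : Fin d => PowerSeries.mk (treeSum p)) N Finset.univ
  simp only [Finset.prod_const, Finset.card_univ, Fintype.card_fin, PowerSeries.coeff_mk] at this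
  rw [this]

theorem coeff_treeSum_pow_eq_zero (p : ℕ → ℝ) {j n : ℕ} (h : n < j) :
    (PowerSeries.mk (treeSum p) ^ j).coeff n = 0 := by
  have h1 : (PowerSeries.X : PowerSeries ℝ) ∣ PowerSeries.mk (treeSum p) := by
    rw [PowerSeries.X_dvd_iff, ← PowerSeries.coeff_zero_eq_constantCoeff_apply,
      PowerSeries.coeff_mk, treeSum_zero]
  exact PowerSeries.X_pow_dvd_iff.1 (pow_dvd_pow_of_dvd h1 j) n h

/-- The recursive decomposition of forests at the root of the first tree. -/
theorem coeff_treeSum_pow_succ (p : ℕ → ℝ) (m n : ℕ) :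
    (PowerSeries.mk (treeSum p) ^ (m + 1)).coeff (n + 1) =
      ∑ j ∈ Finset.range (n + 1), p j * (PowerSeries.mk (treeSum p) ^ (m + j)).coeff n := by
  set A := PowerSeries.mk (treeSum p) with hA
  have h1 : ∀ i ∈ Finset.range (n + 1), treeSum p (i + 1) =
      ∑ j ∈ Finset.range (n + 1), p j * (A ^ j).coeff i := by
    intro i hi
    rw [Finset.mem_range] at hi
    rw [treeSum_succ]
    refine Finset.sum_subset (Finset.range_mono (by omega)) fun j _ hj => ?_
    rw [Finset.mem_range, not_lt] at hj
    rw [coeff_treeSum_pow_eq_zero p (by omega), mul_zero]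
  rw [pow_succ', PowerSeries.coeff_mul, Finset.Nat.sum_antidiagonal_eq_sum_range_succ_mk,
    Finset.sum_range_succ']
  simp only [hA, PowerSeries.coeff_mk, treeSum_zero, zero_mul, add_zero]
  rw [← hA, Finset.sum_congr rfl fun i hi => by rw [h1 i hi]]
  simp_rw [Finset.sum_mul]
  rw [Finset.sum_comm]
  refine Finset.sum_congr rfl fun j _ => ?_
  rw [add_comm m j, pow_add, PowerSeries.coeff_mul,
    Finset.Nat.sum_antidiagonal_eq_sum_range_succ_mk, Finset.mul_sum]
  refine Finset.sum_congr rfl fun i _ => ?_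
  rw [Nat.add_sub_add_right]; ring

theorem sum_mul_coeff_X_pow_mul (q : ℕ → ℝ) (G : PowerSeries ℝ) (n : ℕ) :
    ∑ j ∈ Finset.range (n + 1), q j * (PowerSeries.X ^ j * G).coeff n =
      (PowerSeries.mk q * G).coeff n := by
  rw [PowerSeries.coeff_mul, Finset.Nat.sum_antidiagonal_eq_sum_range_succ_mk]
  refine Finset.sum_congr rfl fun j hj => ?_
  rw [PowerSeries.coeff_X_pow_mul', if_pos (by simpa [Nat.lt_succ_iff] using hj),
    PowerSeries.coeff_mk]

/-- The operator `z d/dz` multiplies the `n`-th coefficient by `n`. -/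
theorem coeff_X_mul_derivative (F : PowerSeries ℝ) (n : ℕ) :
    (PowerSeries.X * PowerSeries.derivative ℝ F).coeff n = n * F.coeff n := by
  cases n with
  | zero => simp
  | succ n =>
    rw [PowerSeries.coeff_succ_X_mul, PowerSeries.coeff_derivative]
    push_cast; ring

/-- The cycle lemma (Lagrange inversion): `n [zⁿ] Aᵐ = m [zⁿ] zᵐ Pⁿ`. -/
theorem coeff_treeSum_pow (p : ℕ → ℝ) (n m : ℕ) :
    (n : ℝ) * (PowerSeries.mk (treeSum p) ^ m).coeff n =
      m * (PowerSeries.X ^ m * PowerSeries.mk p ^ n).coeff n := by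
  induction n generalizing m with
  | zero =>
    cases m with
    | zero => simp
    | succ m => simp [pow_succ']
  | succ n ih =>
    cases m with
    | zero => simp [PowerSeries.coeff_one]
    | succ m =>
      rw [coeff_treeSum_pow_succ, pow_succ' PowerSeries.X m, mul_assoc,
        PowerSeries.coeff_succ_X_mul]
      rcases Nat.eq_zero_or_pos n with rfl | hn
      · cases m with
        | zero => simp
        | succ m => simp [pow_succ', treeSum_zero]
      set P := PowerSeries.mk p with hP
      set A := PowerSeries.mk (treeSum p) with hA
      set K := (PowerSeries.X ^ m * P ^ (n + 1)).coeff n with hK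
      set L := (PowerSeries.X * PowerSeries.derivative ℝ P *
        (PowerSeries.X ^ m * P ^ n)).coeff n with hL
      have hKsum : ∑ j ∈ Finset.range (n + 1),
          p j * (PowerSeries.X ^ j * (PowerSeries.X ^ m * P ^ n)).coeff n = K := by
        rw [sum_mul_coeff_X_pow_mul, hK, pow_succ]
        congr 1; ring
      have hLsum : ∑ j ∈ Finset.range (n + 1),
          (j * p j) * (PowerSeries.X ^ j * (PowerSeries.X ^ m * P ^ n)).coeff n = L := by
        rw [sum_mul_coeff_X_pow_mul (fun j => j * p j), hL]
        congr 2
        ext j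
        rw [coeff_X_mul_derivative, hP, PowerSeries.coeff_mk, PowerSeries.coeff_mk]
      have hder : (n : ℝ) * K = m * K + (n + 1) * L := by
        rw [hK, ← coeff_X_mul_derivative, ← hK]
        have : PowerSeries.X * PowerSeries.derivative ℝ (PowerSeries.X ^ m * P ^ (n + 1)) =
            PowerSeries.C (m : ℝ) * (PowerSeries.X ^ m * P ^ (n + 1)) +
            PowerSeries.C ((n : ℝ) + 1) * (PowerSeries.X * PowerSeries.derivative ℝ P *
              (PowerSeries.X ^ m * P ^ n)) := by
          rw [Derivation.leibniz, PowerSeries.derivative_pow, PowerSeries.derivative_pow,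
            PowerSeries.derivative_X]
          cases m with
          | zero => simp; ring
          | succ m => simp; ring
        rw [this, map_add, PowerSeries.coeff_C_mul, PowerSeries.coeff_C_mul]
      have hS : (n : ℝ) * ∑ j ∈ Finset.range (n + 1), p j * (A ^ (m + j)).coeff n =
          m * K + L := by
        rw [← hKsum, ← hLsum, Finset.mul_sum, Finset.mul_sum, ← Finset.sum_add_distrib]
        refine Finset.sum_congr rfl fun j _ => ?_
        have := ih (m + j)
        rw [pow_add PowerSeries.X, mul_comm (PowerSeries.X ^ m), mul_assoc] at this
        push_cast at this
        linear_combination p j * this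
      have hn' : (n : ℝ) ≠ 0 := by positivity
      apply mul_left_cancel₀ hn'
      push_cast
      linear_combination (n + 1 : ℝ) * hS - hder

theorem coeff_treeSum_pow_le {p : ℕ → ℝ} {C : ℝ}
    (hC : ∀ n N : ℕ, 1 ≤ n → (PowerSeries.mk p ^ n).coeff N ≤ C / √n) (hC0 : 0 < C)
    {n : ℕ} (hn : 1 ≤ n) (m : ℕ) :
    (PowerSeries.mk (treeSum p) ^ m).coeff n ≤ m * C / (n * √n) := by
  have hn' : (0 : ℝ) < n := by exact_mod_cast hn
  have hs : (0 : ℝ) < √n := Real.sqrt_pos.2 hn'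
  rw [← div_div, le_div_iff₀ hs, mul_div_right_comm, ← le_div_iff₀ hs, div_mul_eq_mul_div,
    div_div, mul_comm (n : ℝ), ← div_div, le_div_iff₀ hn', mul_comm _ (n : ℝ), coeff_treeSum_pow,
    mul_div_assoc]
  refine mul_le_mul_of_nonneg_left ?_ (Nat.cast_nonneg _)
  rw [PowerSeries.coeff_X_pow_mul']
  split_ifs
  · exact hC _ _ hn
  · positivity

theorem treeSum_le {p : ℕ → ℝ} {C : ℝ}
    (hC : ∀ n N : ℕ, 1 ≤ n → (PowerSeries.mk p ^ n).coeff N ≤ C / √n) (hC0 : 0 < C)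
    {n : ℕ} (hn : 1 ≤ n) : treeSum p n ≤ C / (n * √n) := by
  simpa using coeff_treeSum_pow_le hC hC0 hn 1

theorem exists_le_treeSum {p : ℕ → ℝ}
    (h : ∃ c : ℝ, 0 < c ∧ ∃ n₀ : ℕ, ∀ n : ℕ, n₀ ≤ n → (PowerSeries.mk p ^ (n + 1)).coeff n ≠ 0 →
      c / √(n + 1 : ℕ) ≤ (PowerSeries.mk p ^ (n + 1)).coeff n) :
    ∃ c : ℝ, 0 < c ∧ ∀ n ∈ gwSupport p, c / (n * √n) ≤ treeSum p n := by
  obtain ⟨c, hc, n₀, h⟩ := h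
  have hfin : ∀ M : ℕ, ∃ c₁ : ℝ, 0 < c₁ ∧ ∀ n ≤ M, 0 < treeSum p n → c₁ ≤ treeSum p n := by
    intro M
    induction M with
    | zero => exact ⟨1, one_pos, fun n hn h => by simp_all [treeSum_zero]⟩
    | succ M ih =>
      obtain ⟨c₁, hc₁, ih⟩ := ih
      by_cases hM : 0 < treeSum p (M + 1)
      · refine ⟨min c₁ (treeSum p (M + 1)), lt_min hc₁ hM, fun n hn hpos => ?_⟩
        rcases Nat.le_succ_iff.1 hn with hn | rfl
        · exact (min_le_left _ _).trans (ih n hn hpos)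
        · exact min_le_right _ _
      · refine ⟨c₁, hc₁, fun n hn hpos => ?_⟩
        rcases Nat.le_succ_iff.1 hn with hn | rfl
        · exact ih n hn hpos
        · exact absurd hpos hM
  obtain ⟨c₁, hc₁, hfin⟩ := hfin n₀
  refine ⟨min c c₁, lt_min hc hc₁, fun n hn => ?_⟩
  obtain ⟨hn1, hpos⟩ := hn
  have hn' : (1 : ℝ) ≤ n := by exact_mod_cast hn1
  have hs : (1 : ℝ) ≤ √n := Real.one_le_sqrt.2 hn'
  rcases le_or_gt n n₀ with hle | hlt
  · refine le_trans ?_ (hfin n hle hpos)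
    exact (div_le_self (lt_min hc hc₁).le (one_le_mul_of_one_le_of_one_le hn' hs)).trans
      (min_le_right _ _)
  · obtain ⟨m, rfl⟩ : ∃ m, n = m + 1 := ⟨n - 1, by omega⟩
    have key := coeff_treeSum_pow p (m + 1) 1
    rw [pow_one, PowerSeries.coeff_mk, pow_one, PowerSeries.coeff_succ_X_mul, Nat.cast_one,
      one_mul] at key
    have hne : (PowerSeries.mk p ^ (m + 1)).coeff m ≠ 0 := by
      rw [← key]; positivity
    have h2 := h m (by omega) hne
    rw [← key] at h2
    have hsp : 0 < √((m + 1 : ℕ) : ℝ) := by linarith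
    rw [div_le_iff₀ hsp] at h2
    rw [div_le_iff₀ (by positivity)]
    refine (min_le_left c c₁).trans (h2.trans_eq ?_)
    ring

theorem one_div_mul_sqrt_le {x : ℝ} (hx : 1 ≤ x) :
    1 / (x * √x) ≤ 4 * (1 / √x - 1 / √(x + 1)) := by
  have hu : 0 < √x := Real.sqrt_pos.2 (by linarith)
  have hv : 0 < √(x + 1) := Real.sqrt_pos.2 (by linarith)
  have hu2 : √x ^ 2 = x := Real.sq_sqrt (by linarith)
  have hv2 : √(x + 1) ^ 2 = x + 1 := Real.sq_sqrt (by linarith)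
  have huv : √x ≤ √(x + 1) := Real.sqrt_le_sqrt (by linarith)
  set u := √x
  set v := √(x + 1)
  have h1 : 1 / u - 1 / v = 1 / (u * v * (u + v)) := by
    field_simp
    nlinarith
  rw [h1, ← hu2, ← mul_div_assoc, mul_one, div_le_div_iff₀ (by positivity) (by positivity), one_mul]
  have h2 : v ≤ 2 * u := by nlinarith
  nlinarith [mul_pos hu hv, mul_le_mul_of_nonneg_left h2 hu.le, mul_pos hu hu]

theorem sum_tail_le {a : ℕ → ℝ} {C : ℝ} (hC0 : 0 < C)
    (ha : ∀ n : ℕ, 1 ≤ n → a n ≤ C / (n * √n)) {s : ℝ} (hs : 0 < s) (n : ℕ) :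
    ∑ x ∈ Finset.range n, (if s ≤ (x : ℝ) then a x else 0) ≤ 4 * C / √s := by
  have key : ∑ x ∈ Finset.range n, (if s ≤ (x : ℝ) then a x else 0) ≤
      4 * C * (1 / √s - 1 / √(max s n)) := by
    induction n with
    | zero => simp [max_eq_left hs.le]
    | succ n ih =>
      rw [Finset.sum_range_succ]
      split_ifs with h
      · have hn : 1 ≤ n := by
          rcases Nat.eq_zero_or_pos n with rfl | hn
          · simp at h; linarith
          · exact hn
        have hn' : (1 : ℝ) ≤ n := by exact_mod_cast hn
        rw [max_eq_right h] at ih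
        rw [max_eq_right (by push_cast; linarith)]
        have h1 := one_div_mul_sqrt_le hn'
        have h2 := ha n hn
        have h3 : C / (n * √n) = C * (1 / (n * √n)) := by ring
        push_cast
        nlinarith
      · rw [add_zero]
        refine ih.trans ?_
        have h1 : √(max s n) ≤ √(max s (n + 1 : ℕ)) :=
          Real.sqrt_le_sqrt (max_le_max_left s (by simp))
        have h2 : 0 < √(max s n) := Real.sqrt_pos.2 (lt_max_of_lt_left hs)
        have h3 := one_div_le_one_div_of_le h2 h1
        exact mul_le_mul_of_nonneg_left (by linarith) (by positivity)
  refine key.trans ?_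
  rw [mul_sub, mul_one_div]
  have : 0 ≤ 4 * C * (1 / √(max s n)) := by positivity
  linarith

end TreeSeries

section RootDecomposition

theorem sum_prod_le_of_large_coords {ι : Type*} [Fintype ι] [DecidableEq ι] {a : ℕ → ℝ}
    (ha : ∀ n, 0 ≤ a n) (S : Finset ι) {s B D : ℝ} {k N : ℕ} (hB0 : 0 ≤ B)
    (hB : ∀ M ≤ N, N ≤ k * M → (PowerSeries.mk a ^ Sᶜ.card).coeff M ≤ B)
    (hD : ∑ x ∈ Finset.range (N + 1), (if s ≤ (x : ℝ) then a x else 0) ≤ D)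
    {X : Finset (ι → ℕ)} (hmem : ∀ x ∈ X, ∑ i, x i = N ∧ (∀ i ∈ S, s ≤ ((x i : ℕ) : ℝ)) ∧
      N ≤ k * ∑ i ∈ Sᶜ, x i) :
    ∑ x ∈ X, ∏ i, a (x i) ≤ D ^ S.card * B := by
  let g : (ι → ℕ) → ι → ℕ := fun x i => if i ∈ S then x i else 0
  let h : (ι → ℕ) → ι → ℕ := fun x i => if i ∈ S then 0 else x i
  let t : ι → Finset ℕ := fun i =>
    if i ∈ S then (Finset.range (N + 1)).filter fun v : ℕ => s ≤ (v : ℝ) else {0}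
  have hmaps : ∀ x ∈ X, g x ∈ Fintype.piFinset t := by
    intro x hx
    obtain ⟨hsum, hS, -⟩ := hmem x hx
    rw [Fintype.mem_piFinset]
    intro i
    by_cases hi : i ∈ S
    · simp only [g, t, if_pos hi, Finset.mem_filter, Finset.mem_range]
      refine ⟨?_, hS i hi⟩
      have := Finset.single_le_sum (f := x) (fun _ _ => Nat.zero_le _) (Finset.mem_univ i)
      omega
    · simp [g, t, hi]
  have hfiber : ∀ y : ι → ℕ, ∑ x ∈ X with g x = y, ∏ i, a (x i) ≤
      (∏ i, if i ∈ S then a (y i) else 1) * B := by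
    intro y
    have hy0 : 0 ≤ ∏ i, if i ∈ S then a (y i) else 1 :=
      Finset.prod_nonneg fun i _ => by split_ifs <;> simp [ha]
    rcases (X.filter fun x => g x = y).eq_empty_or_nonempty with he | ⟨x₀, hx₀⟩
    · rw [he, Finset.sum_empty]
      exact mul_nonneg hy0 hB0
    set M := N - ∑ i ∈ S, y i with hM
    have hrest : ∀ x ∈ X.filter (fun x => g x = y), ∑ i ∈ Sᶜ, x i = M := by
      intro x hx
      obtain ⟨hxX, rfl⟩ := Finset.mem_filter.1 hx
      have h1 := Finset.sum_add_sum_compl S x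
      have h2 : ∑ i ∈ S, g x i = ∑ i ∈ S, x i :=
        Finset.sum_congr rfl fun i hi => by simp [g, hi]
      rw [hM, h2, ← (hmem x hxX).1]
      omega
    have hMk : (PowerSeries.mk a ^ Sᶜ.card).coeff M ≤ B := by
      refine hB M (Nat.sub_le _ _) ?_
      rw [← hrest x₀ hx₀]
      exact (hmem x₀ (Finset.mem_filter.1 hx₀).1).2.2
    have hsplit : ∀ x ∈ X.filter (fun x => g x = y), ∏ i, a (x i) =
        (∏ i, if i ∈ S then a (y i) else 1) * ∏ i ∈ Sᶜ, a (h x i) := by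
      intro x hx
      obtain ⟨hx, rfl⟩ := Finset.mem_filter.1 hx
      rw [← Finset.prod_mul_prod_compl S fun i => a (x i), Finset.prod_ite_mem,
        Finset.univ_inter]
      congr 1
      · exact Finset.prod_congr rfl fun i hi => by simp [g, hi]
      · exact Finset.prod_congr rfl fun i hi => by simp [h, Finset.mem_compl.1 hi]
    rw [Finset.sum_congr rfl hsplit, ← Finset.mul_sum]
    refine mul_le_mul_of_nonneg_left (le_trans ?_ hMk) hy0
    have hcoeff := coeff_prod_eq_sum_piAntidiag (fun _ : ι => PowerSeries.mk a) M Sᶜ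
    simp only [Finset.prod_const, PowerSeries.coeff_mk] at hcoeff
    rw [hcoeff, ← Finset.sum_image (f := fun z : ι → ℕ => ∏ i ∈ Sᶜ, a (z i)) (g := h)]
    · refine Finset.sum_le_sum_of_subset_of_nonneg ?_
        fun z _ _ => Finset.prod_nonneg fun i _ => ha _
      intro z hz
      obtain ⟨x, hx, rfl⟩ := Finset.mem_image.1 hz
      rw [Finset.mem_piAntidiag]
      refine ⟨?_, fun i hi => ?_⟩
      · rw [← hrest x hx]
        exact Finset.sum_congr rfl fun i hi => by simp [h, Finset.mem_compl.1 hi]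
      · rw [Finset.mem_compl]
        intro hiS
        simp [h, hiS] at hi
    · intro x hx x' hx' hxx
      have hg : g x = g x' := by
        rw [(Finset.mem_filter.1 hx).2, (Finset.mem_filter.1 hx').2]
      funext i
      have h1 := congrFun hg i
      have h2 := congrFun hxx i
      by_cases hi : i ∈ S
      · simpa [g, hi] using h1
      · simpa [h, hi] using h2
  rw [← Finset.sum_fiberwise_of_maps_to hmaps]
  refine (Finset.sum_le_sum fun y _ => hfiber y).trans ?_
  rw [← Finset.sum_mul]
  refine mul_le_mul_of_nonneg_right ?_ hB0
  rw [← Finset.prod_univ_sum t fun i v => if i ∈ S then a v else 1]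
  have hprod : ∀ i, (∑ v ∈ t i, if i ∈ S then a v else 1) =
      if i ∈ S then ∑ x ∈ Finset.range (N + 1), (if s ≤ (x : ℝ) then a x else 0) else 1 := by
    intro i
    by_cases hi : i ∈ S
    · simp only [t, if_pos hi, Finset.sum_filter]
    · simp [t, hi]
  rw [Finset.prod_congr rfl fun i _ => hprod i, Finset.prod_ite_mem, Finset.univ_inter,
    Finset.prod_const]
  exact pow_le_pow_left₀ (Finset.sum_nonneg fun i _ => by split_ifs <;> simp [ha]) hD _

/-- If at least `k` coordinates are large, then `k - 1` of them can be chosen so that the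
remaining ones still carry a fraction `1 / k` of the total. -/
theorem exists_powersetCard_of_large_coords {ι : Type*} [Fintype ι] [DecidableEq ι]
    {x : ι → ℕ} {s : ℝ} {k : ℕ} (hk : 2 ≤ k)
    (h : k ≤ (Finset.univ.filter fun i => s ≤ ((x i : ℕ) : ℝ)).card) :
    ∃ S ∈ Finset.powersetCard (k - 1) (Finset.univ : Finset ι),
      (∀ i ∈ S, s ≤ ((x i : ℕ) : ℝ)) ∧ ∑ i, x i ≤ k * ∑ i ∈ Sᶜ, x i := by
  set K := Finset.univ.filter fun i => s ≤ ((x i : ℕ) : ℝ) with hK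
  have hne : (Finset.univ : Finset ι).Nonempty :=
    (Finset.card_pos.1 (by omega : 0 < K.card)).mono (Finset.subset_univ _)
  obtain ⟨m, -, hm⟩ := Finset.exists_max_image Finset.univ x hne
  have hcard : k - 1 ≤ (K.erase m).card := by
    have := Finset.pred_card_le_card_erase (s := K) (a := m)
    omega
  obtain ⟨S, hS, hScard⟩ := Finset.exists_subset_card_eq hcard
  have hmS : m ∉ S := fun hmem => Finset.notMem_erase m K (hS hmem)
  refine ⟨S, Finset.mem_powersetCard.2 ⟨Finset.subset_univ _, hScard⟩, fun i hi => ?_, ?_⟩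
  · exact (Finset.mem_filter.1 (Finset.mem_of_mem_erase (hS hi))).2
  · have h1 : ∑ i ∈ S, x i ≤ (k - 1) * x m := by
      rw [← hScard, ← smul_eq_mul]
      exact Finset.sum_le_card_nsmul _ _ _ fun i _ => hm i (Finset.mem_univ i)
    have h2 : x m ≤ ∑ i ∈ Sᶜ, x i :=
      Finset.single_le_sum (f := x) (fun _ _ => Nat.zero_le _) (Finset.mem_compl.2 hmS)
    have h3 := Finset.sum_add_sum_compl S x
    have h4 : (k - 1) * x m ≤ (k - 1) * ∑ i ∈ Sᶜ, x i := Nat.mul_le_mul_left _ h2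
    obtain ⟨j, rfl⟩ : ∃ j, k = j + 1 := ⟨k - 1, by omega⟩
    simp only [Nat.add_sub_cancel] at h1 h4
    rw [add_mul, one_mul]
    omega

theorem sum_biUnion_le {ι α : Type*} [DecidableEq ι] [DecidableEq α] {f : α → ℝ} (I : Finset ι)
    (Y : ι → Finset α) (hf : ∀ x, 0 ≤ f x) :
    ∑ x ∈ I.biUnion Y, f x ≤ ∑ i ∈ I, ∑ x ∈ Y i, f x := by
  induction I using Finset.induction_on with
  | empty => simp
  | insert i I hi ih =>
    rw [Finset.biUnion_insert, Finset.sum_insert hi]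
    have h := Finset.sum_union_inter (s₁ := Y i) (s₂ := I.biUnion Y) (f := f)
    have h2 : 0 ≤ ∑ x ∈ Y i ∩ I.biUnion Y, f x := Finset.sum_nonneg fun x _ => hf x
    linarith

theorem sum_prod_le_of_card_large {a : ℕ → ℝ} (ha : ∀ n, 0 ≤ a n) {s B D : ℝ} {d k N : ℕ}
    (hk : 2 ≤ k) (hB0 : 0 ≤ B) (hD0 : 0 ≤ D)
    (hB : ∀ m ≤ d, ∀ M ≤ N, N ≤ k * M → (PowerSeries.mk a ^ m).coeff M ≤ B)
    (hD : ∑ x ∈ Finset.range (N + 1), (if s ≤ (x : ℝ) then a x else 0) ≤ D) :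
    ∑ x ∈ Finset.piAntidiag (Finset.univ : Finset (Fin d)) N with
        k ≤ (Finset.univ.filter fun i => s ≤ ((x i : ℕ) : ℝ)).card, ∏ i, a (x i) ≤
      (d : ℝ) ^ (k - 1) * (D ^ (k - 1) * B) := by
  have hnn : ∀ x : Fin d → ℕ, 0 ≤ ∏ i, a (x i) := fun x => Finset.prod_nonneg fun i _ => ha _
  let Y : Finset (Fin d) → Finset (Fin d → ℕ) := fun S =>
    (Finset.piAntidiag Finset.univ N).filter
      fun x => (∀ i ∈ S, s ≤ ((x i : ℕ) : ℝ)) ∧ N ≤ k * ∑ i ∈ Sᶜ, x i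
  have hsub : (Finset.piAntidiag (Finset.univ : Finset (Fin d)) N).filter
      (fun x => k ≤ (Finset.univ.filter fun i => s ≤ ((x i : ℕ) : ℝ)).card) ⊆
      (Finset.powersetCard (k - 1) Finset.univ).biUnion Y := by
    intro x hx
    obtain ⟨hx1, hx2⟩ := Finset.mem_filter.1 hx
    obtain ⟨S, hS, h1, h2⟩ := exists_powersetCard_of_large_coords hk hx2
    refine Finset.mem_biUnion.2 ⟨S, hS, Finset.mem_filter.2 ⟨hx1, h1, ?_⟩⟩
    have : ∑ i, x i = N := (Finset.mem_piAntidiag.1 hx1).1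
    rwa [this] at h2
  calc _ ≤ ∑ x ∈ (Finset.powersetCard (k - 1) Finset.univ).biUnion Y, ∏ i, a (x i) :=
        Finset.sum_le_sum_of_subset_of_nonneg hsub fun x _ _ => hnn x
    _ ≤ ∑ S ∈ Finset.powersetCard (k - 1) Finset.univ, ∑ x ∈ Y S, ∏ i, a (x i) :=
        sum_biUnion_le _ _ hnn
    _ ≤ ∑ S ∈ Finset.powersetCard (k - 1) (Finset.univ : Finset (Fin d)), D ^ (k - 1) * B := by
        refine Finset.sum_le_sum fun S hS => ?_
        rw [← (Finset.mem_powersetCard.1 hS).2]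
        exact sum_prod_le_of_large_coords ha S hB0
          (hB _ ((Finset.card_le_univ _).trans_eq (Fintype.card_fin d))) hD
          fun x hx => ⟨(Finset.mem_piAntidiag.1 (Finset.mem_filter.1 hx).1).1,
            (Finset.mem_filter.1 hx).2⟩
    _ ≤ _ := by
        rw [Finset.sum_const, Finset.card_powersetCard, Finset.card_univ, Fintype.card_fin,
          nsmul_eq_mul]
        refine mul_le_mul_of_nonneg_right ?_ (by positivity)
        exact_mod_cast Nat.choose_le_pow d (k - 1)

end RootDecomposition

section OrderStatistics

theorem le_countP_of_le_getD_sort {l : List ℕ} {k : ℕ} {s : ℝ} (hk : 1 ≤ k) (hs : 0 < s)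
    (h : s ≤ (((l.insertionSort (· ≥ ·)).getD (k - 1) 0 : ℕ) : ℝ)) :
    k ≤ l.countP fun v => decide (s ≤ ((v : ℕ) : ℝ)) := by
  set L := l.insertionSort (· ≥ ·) with hL
  have hpw : L.Pairwise (· ≥ ·) := List.pairwise_insertionSort _ _
  have hlt : k - 1 < L.length := by
    by_contra hge
    rw [List.getD_eq_default _ _ (not_lt.1 hge), Nat.cast_zero] at h
    linarith
  rw [List.getD_eq_getElem _ _ hlt] at h
  have hall : ∀ v ∈ L.take k, decide (s ≤ ((v : ℕ) : ℝ)) = true := by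
    intro v hv
    obtain ⟨i, hi, rfl⟩ := List.mem_take_iff_getElem.1 hv
    rw [decide_eq_true_iff]
    refine h.trans (Nat.cast_le.2 ?_)
    rcases Nat.lt_or_ge i (k - 1) with hik | hik
    · exact List.pairwise_iff_getElem.1 hpw i (k - 1) _ _ hik
    · have : i = k - 1 := by omega
      subst this
      exact le_rfl
  rw [← (List.perm_insertionSort (· ≥ ·) l).countP_eq]
  calc k = (L.take k).length := by rw [List.length_take]; omega
    _ = (L.take k).countP fun v => decide (s ≤ ((v : ℕ) : ℝ)) :=
        (List.countP_eq_length.2 hall).symm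
    _ ≤ _ := (List.take_sublist k L).countP_le

theorem sum_drop_sort_le (l : List ℕ) (j : ℕ) :
    ((l.insertionSort (· ≥ ·)).drop j).sum ≤
      l.length * (l.insertionSort (· ≥ ·)).getD j 0 := by
  set L := l.insertionSort (· ≥ ·) with hL
  have hpw : L.Pairwise (· ≥ ·) := List.pairwise_insertionSort _ _
  have hlen : L.length = l.length := (List.perm_insertionSort (· ≥ ·) l).length_eq
  rcases Nat.lt_or_ge j L.length with hj | hj
  · rw [List.getD_eq_getElem _ _ hj]
    refine (List.sum_le_card_nsmul (L.drop j) L[j] fun v hv => ?_).trans ?_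
    · obtain ⟨i, hi, rfl⟩ := List.mem_drop_iff_getElem.1 hv
      rcases Nat.eq_zero_or_pos i with rfl | hi0
      · exact le_of_eq (by simp)
      · exact List.pairwise_iff_getElem.1 hpw j (j + i) _ _ (by omega)
    · rw [smul_eq_mul, List.length_drop, hlen]
      exact Nat.mul_le_mul_right _ (Nat.sub_le _ _)
  · rw [List.drop_eq_nil_of_le hj]
    simp

theorem countP_ofFn {d : ℕ} (x : Fin d → ℕ) (P : ℕ → Prop) [DecidablePred P] :
    (List.ofFn x).countP (fun v => decide (P v)) = (Finset.univ.filter fun i => P (x i)).card := by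
  rw [← Multiset.coe_countP, ← Fin.univ_val_map, Multiset.countP_map]
  rfl

namespace PTree

theorem length_childSizes (T : PTree) : T.childSizes.length = T.rootDeg := by
  cases T
  simp [childSizes, rootDeg]

theorem le_countP_childSizes {T : PTree} {k : ℕ} {s : ℝ} (hk : 1 ≤ k) (hs : 0 < s)
    (h : s ≤ (T.Nk k : ℝ)) : k ≤ T.childSizes.countP fun v => decide (s ≤ ((v : ℕ) : ℝ)) :=
  le_countP_of_le_getD_sort hk hs h

theorem NkPlus_le (T : PTree) (k : ℕ) : T.NkPlus k ≤ T.rootDeg * T.Nk k := by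
  rw [← length_childSizes]
  exact sum_drop_sort_le _ _

theorem one_le_rootDeg_of_Nk_pos {T : PTree} {k : ℕ} (h : 0 < T.Nk k) : 1 ≤ T.rootDeg := by
  rw [← length_childSizes, Nat.one_le_iff_ne_zero]
  intro h0
  rw [List.length_eq_zero_iff] at h0
  simp [Nk, sortedSizesDesc, h0] at h

end PTree

end OrderStatistics

section TailBounds

theorem one_div_mul_sqrt_le_of_le {N M k : ℕ} (hk : 1 ≤ k) (hM : 1 ≤ M) (hN : N ≤ k * M) :
    1 / (M * √M) ≤ 2 * k * √(2 * k) / ((N + 1 : ℕ) * √((N + 1 : ℕ) : ℝ)) := by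
  have hM' : (0 : ℝ) < M := by exact_mod_cast hM
  have hle : ((N + 1 : ℕ) : ℝ) ≤ 2 * k * M := by
    have : N + 1 ≤ 2 * k * M := by nlinarith [Nat.mul_pos hk hM]
    exact_mod_cast this
  rw [div_le_div_iff₀ (by positivity) (by positivity), one_mul]
  calc ((N + 1 : ℕ) : ℝ) * √((N + 1 : ℕ) : ℝ) ≤ (2 * k * M) * √(2 * k * M) := by gcongr
    _ = _ := by rw [Real.sqrt_mul (by positivity)]; ring

open Classical in
theorem exists_weighted_tail_le {p : ℕ → ℝ} (hp : ∀ i, 0 ≤ p i) {C : ℝ} (hC0 : 0 < C)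
    (hC : ∀ n N : ℕ, 1 ≤ n → (PowerSeries.mk p ^ n).coeff N ≤ C / √n)
    {c : ℝ} (hc0 : 0 < c) (hc : ∀ n ∈ gwSupport p, c / (n * √n) ≤ treeSum p n)
    {k : ℕ} (hk : 2 ≤ k) {w : ℕ → ℝ} (hw : ∀ d, 1 ≤ d → 0 < w d) (e : ℕ)
    (hmom : Summable fun d : ℕ => (d : ℝ) ^ e * (d : ℝ) ^ k * √(w d) ^ (k - 1) * p d)
    {g : ℝ → PTree → ℝ} (hg : ∀ t T, g t T ≤ (T.rootDeg : ℝ) ^ e)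
    (hg_pos : ∀ t T, 1 ≤ t → 0 < g t T → 1 ≤ T.rootDeg ∧ t ≤ w T.rootDeg * T.Nk k) :
    ∃ β : ℝ, 0 < β ∧ ∀ t : ℝ, 1 ≤ t → ∀ n ∈ gwSupport p,
      (∑ T ∈ PTree.ofSize n, weight p T * g t T) / treeSum p n ≤
        β * t ^ ((1 - (k : ℝ)) / 2) := by
  set A := ∑' d : ℕ, (d : ℝ) ^ e * (d : ℝ) ^ k * √(w d) ^ (k - 1) * p d with hA
  have hA0 : 0 ≤ A := tsum_nonneg fun d => mul_nonneg (by positivity) (hp d)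
  set C' := 1 + 2 * k * √(2 * k) * C with hC'
  have hC'0 : 0 < C' := by positivity
  refine ⟨(4 * C) ^ (k - 1) * C' / c * (A + 1), by positivity, fun t ht n hn => ?_⟩
  have ht0 : 0 < t := by linarith
  have hst : 0 < √t := Real.sqrt_pos.2 ht0
  have htr : t ^ ((1 - (k : ℝ)) / 2) = (√t ^ (k - 1))⁻¹ := by
    rw [Real.sqrt_eq_rpow, ← Real.rpow_natCast, ← Real.rpow_mul ht0.le, ← Real.rpow_neg ht0.le,
      Nat.cast_sub (by omega)]
    congr 1; push_cast; ring
  have hn1 := hn.1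
  have hpos := hn.2
  obtain ⟨N, rfl⟩ : ∃ N, n = N + 1 := ⟨n - 1, by omega⟩
  set R := ((N + 1 : ℕ) : ℝ) * √((N + 1 : ℕ) : ℝ) with hR
  have hR0 : 0 < R := by positivity
  have ha := treeSum_nonneg hp
  have hcoeff : ∀ d : ℕ, 1 ≤ d → ∀ m ≤ d, ∀ M ≤ N, N ≤ k * M →
      (PowerSeries.mk (treeSum p) ^ m).coeff M ≤ d * C' / R := by
    intro d hd m hm M hM hNM
    have hd' : (1 : ℝ) ≤ d := by exact_mod_cast hd
    rcases Nat.eq_zero_or_pos M with rfl | hM0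
    · obtain rfl : N = 0 := by simpa using hNM
      have h1 : (PowerSeries.mk (treeSum p) ^ m).coeff 0 ≤ 1 := by
        rcases Nat.eq_zero_or_pos m with rfl | hm0
        · simp
        · rw [coeff_treeSum_pow_eq_zero p hm0]; exact zero_le_one
      have h2 : R = 1 := by simp [hR]
      have h3 : 1 ≤ C' := by rw [hC']; linarith [show 0 ≤ 2 * k * √(2 * k) * C by positivity]
      rw [h2, div_one]
      nlinarith
    · calc _ ≤ m * C / (M * √M) := coeff_treeSum_pow_le hC hC0 hM0 m
        _ ≤ d * C / (M * √M) := by gcongr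
        _ = d * C * (1 / (M * √M)) := by ring
        _ ≤ d * C * (2 * k * √(2 * k) / R) :=
            mul_le_mul_of_nonneg_left (one_div_mul_sqrt_le_of_le (by omega) hM0 hNM) (by positivity)
        _ = d * (2 * k * √(2 * k) * C) / R := by ring
        _ ≤ d * C' / R := by rw [hC']; gcongr; linarith
  let φ : List ℕ → ℝ := fun l =>
    if 1 ≤ l.length ∧ k ≤ l.countP (fun v => decide (t / w l.length ≤ ((v : ℕ) : ℝ))) then
      (l.length : ℝ) ^ e else 0
  have hgφ : ∀ T, g t T ≤ φ T.childSizes := by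
    intro T
    simp only [φ, PTree.length_childSizes]
    rcases le_or_gt (g t T) 0 with h0 | h0
    · refine h0.trans ?_
      split_ifs <;> positivity
    · obtain ⟨h1, h2⟩ := hg_pos t T ht h0
      rw [if_pos]
      · exact hg t T
      · refine ⟨h1, PTree.le_countP_childSizes (by omega) (div_pos ht0 (hw _ h1)) ?_⟩
        rw [div_le_iff₀ (hw _ h1), mul_comm]
        exact h2
  have hterm : ∀ d ∈ Finset.range (N + 1), p d *
      ∑ x ∈ Finset.piAntidiag (Finset.univ : Finset (Fin d)) N,
        (∏ i, treeSum p (x i)) * φ (List.ofFn x) ≤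
      (d : ℝ) ^ e * (d : ℝ) ^ k * √(w d) ^ (k - 1) * p d *
        ((4 * C) ^ (k - 1) * C' * (√t ^ (k - 1))⁻¹ / R) := by
    intro d _
    rcases Nat.eq_zero_or_pos d with rfl | hd
    · refine le_trans (le_of_eq ?_) (mul_nonneg (mul_nonneg (by positivity) (hp 0)) (by positivity))
      simp [φ]
    have hwd := hw d hd
    have hsum : ∑ x ∈ Finset.piAntidiag (Finset.univ : Finset (Fin d)) N,
        (∏ i, treeSum p (x i)) * φ (List.ofFn x) =
        (d : ℝ) ^ e * ∑ x ∈ Finset.piAntidiag (Finset.univ : Finset (Fin d)) N with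
          k ≤ (Finset.univ.filter fun i => t / w d ≤ ((x i : ℕ) : ℝ)).card,
          ∏ i, treeSum p (x i) := by
      rw [Finset.sum_filter, Finset.mul_sum]
      refine Finset.sum_congr rfl fun x _ => ?_
      simp only [φ, List.length_ofFn, countP_ofFn x fun v => t / w d ≤ ((v : ℕ) : ℝ)]
      by_cases h : k ≤ (Finset.univ.filter fun i => t / w d ≤ ((x i : ℕ) : ℝ)).card
      · rw [if_pos ⟨hd, h⟩, if_pos h, mul_comm]
      · rw [if_neg fun h' => h h'.2, if_neg h, mul_zero, mul_zero]
    have hbound := sum_prod_le_of_card_large (d := d) ha hk (by positivity) (by positivity)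
      (hcoeff d hd) (sum_tail_le hC0 (fun n hn => treeSum_le hC hC0 hn) (div_pos ht0 hwd) (N + 1))
    rw [hsum]
    calc _ ≤ p d * ((d : ℝ) ^ e * ((d : ℝ) ^ (k - 1) *
          ((4 * C / √(t / w d)) ^ (k - 1) * (d * C' / R)))) := by
          refine mul_le_mul_of_nonneg_left (mul_le_mul_of_nonneg_left ?_ (by positivity)) (hp d)
          exact hbound
      _ = _ := by
          rw [Real.sqrt_div ht0.le, div_div_eq_mul_div, div_pow, mul_pow]
          obtain ⟨j, rfl⟩ : ∃ j, k = j + 1 := ⟨k - 1, by omega⟩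
          simp only [Nat.add_sub_cancel]
          rw [pow_succ (d : ℝ) j]
          field_simp
  have hnum : ∑ T ∈ PTree.ofSize (N + 1), weight p T * g t T ≤
      A * ((4 * C) ^ (k - 1) * C' * (√t ^ (k - 1))⁻¹ / R) := by
    calc _ ≤ ∑ T ∈ PTree.ofSize (N + 1), weight p T * φ T.childSizes :=
          Finset.sum_le_sum fun T _ => mul_le_mul_of_nonneg_left (hgφ T) (T.weight_nonneg hp)
      _ ≤ _ := by
          rw [PTree.sum_ofSize_succ]
          refine (Finset.sum_le_sum hterm).trans ?_
          rw [← Finset.sum_mul]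
          refine mul_le_mul_of_nonneg_right ?_ (by positivity)
          exact hmom.sum_le_tsum _ fun d _ => mul_nonneg (by positivity) (hp d)
  have hcR : 1 / R ≤ treeSum p (N + 1) / c := by
    have := hc _ hn
    rw [le_div_iff₀ hc0]
    exact le_trans (le_of_eq (by ring)) this
  rw [div_le_iff₀ hpos, htr]
  calc _ ≤ A * ((4 * C) ^ (k - 1) * C' * (√t ^ (k - 1))⁻¹ / R) := hnum
    _ = A * ((4 * C) ^ (k - 1) * C' * (√t ^ (k - 1))⁻¹) * (1 / R) := by ring
    _ ≤ (A + 1) * ((4 * C) ^ (k - 1) * C' * (√t ^ (k - 1))⁻¹) * (treeSum p (N + 1) / c) := by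
        gcongr
        linarith
    _ = _ := by ring

theorem summable_of_momentFinite {p : ℕ → ℝ} (hp : ∀ i, 0 ≤ p i) {m r : ℝ}
    (hm : MomentFinite p m) (hr : r ≤ m) {f : ℕ → ℝ} (hf0 : f 0 = 0)
    (hf : ∀ d : ℕ, 1 ≤ d → f d = (d : ℝ) ^ r) : Summable fun d => f d * p d := by
  refine Summable.of_nonneg_of_le (fun d => mul_nonneg ?_ (hp d))
    (fun d => mul_le_mul_of_nonneg_right ?_ (hp d)) hm
  · rcases Nat.eq_zero_or_pos d with rfl | hd
    · exact hf0.ge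
    · rw [hf d hd]; positivity
  · rcases Nat.eq_zero_or_pos d with rfl | hd
    · rw [hf0]; positivity
    · rw [hf d hd]
      exact Real.rpow_le_rpow_of_exponent_le (by exact_mod_cast hd) hr

theorem summable_moment_one {p : ℕ → ℝ} (hp : ∀ i, 0 ≤ p i) {m : ℝ} (hm : MomentFinite p m)
    {e k : ℕ} (hk : 2 ≤ k) (h : (e : ℝ) + k ≤ m) :
    Summable fun d : ℕ => (d : ℝ) ^ e * (d : ℝ) ^ k * √(1 : ℝ) ^ (k - 1) * p d := by
  refine summable_of_momentFinite hp hm h ?_ fun d hd => ?_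
  · simp [show k ≠ 0 by omega]
  · have hd' : (0 : ℝ) < d := by exact_mod_cast hd
    rw [Real.sqrt_one, one_pow, mul_one, Real.rpow_add hd', Real.rpow_natCast, Real.rpow_natCast]

theorem summable_moment_natCast {p : ℕ → ℝ} (hp : ∀ i, 0 ≤ p i) {m : ℝ} (hm : MomentFinite p m)
    {e k : ℕ} (hk : 2 ≤ k) (h : (e : ℝ) + k + ((k : ℝ) - 1) / 2 ≤ m) :
    Summable fun d : ℕ => (d : ℝ) ^ e * (d : ℝ) ^ k * √(d : ℝ) ^ (k - 1) * p d := by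
  refine summable_of_momentFinite hp hm h ?_ fun d hd => ?_
  · simp [show k ≠ 0 by omega]
  · have hd' : (0 : ℝ) < d := by exact_mod_cast hd
    rw [Real.rpow_add hd', Real.rpow_add hd', Real.rpow_natCast, Real.rpow_natCast,
      Real.sqrt_eq_rpow, ← Real.rpow_natCast _ (k - 1), ← Real.rpow_mul hd'.le,
      Nat.cast_sub (by omega)]
    congr 2
    push_cast; ring

namespace PTree

theorem one_le_rootDeg_and_le_Nk {T : PTree} {k : ℕ} {t : ℝ} (ht : 1 ≤ t)
    (h : t ≤ (T.Nk k : ℝ)) : 1 ≤ T.rootDeg ∧ t ≤ 1 * (T.Nk k : ℝ) := by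
  refine ⟨one_le_rootDeg_of_Nk_pos (k := k) ?_, by rwa [one_mul]⟩
  exact_mod_cast (by linarith : (0 : ℝ) < T.Nk k)

theorem one_le_rootDeg_and_le_mul_Nk {T : PTree} {k : ℕ} {t : ℝ} (ht : 1 ≤ t)
    (h : t ≤ (T.NkPlus k : ℝ)) : 1 ≤ T.rootDeg ∧ t ≤ (T.rootDeg : ℝ) * (T.Nk k : ℝ) := by
  have h1 : (T.NkPlus k : ℝ) ≤ T.rootDeg * T.Nk k := by exact_mod_cast NkPlus_le T k
  refine ⟨one_le_rootDeg_of_Nk_pos (k := k) (Nat.pos_of_ne_zero fun h0 => ?_), h.trans h1⟩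
  rw [h0, Nat.cast_zero, mul_zero] at h1
  linarith

end PTree

end TailBounds

/-- tail bounds for `N_k` and `N_{k+}` at the root of `τ_n`. -/
theorem stmt_6 (p : ℕ → ℝ)
    (hp_nonneg : ∀ i, 0 ≤ p i)
    (hp_sum : ∑' i : ℕ, p i = 1)
    (hp_mean : ∑' i : ℕ, (i : ℝ) * p i = 1)
    (hp_sq : Summable (fun i : ℕ => (i : ℝ) ^ 2 * p i))
    (hp_var : 1 < ∑' i : ℕ, (i : ℝ) ^ 2 * p i)
    (k : ℕ) (hk : 2 ≤ k) :
    (MomentFinite p ((k : ℝ) + 1) →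
      ∃ βk : ℝ, 0 < βk ∧ ∀ t : ℝ, 1 ≤ t → ∀ n ∈ gwSupport p,
        condProb p n (fun T => t ≤ (PTree.Nk k T : ℝ)) ≤ βk * t ^ ((1 - (k : ℝ)) / 2))
    ∧ (MomentFinite p ((3 * (k : ℝ) + 1) / 2) →
        ∃ βkp : ℝ, 0 < βkp ∧ ∀ t : ℝ, 1 ≤ t → ∀ n ∈ gwSupport p,
          condProb p n (fun T => t ≤ (PTree.NkPlus k T : ℝ)) ≤ βkp * t ^ ((1 - (k : ℝ)) / 2))
    ∧ (MomentFinite p ((k : ℝ) + 2) →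
        ∃ β : ℝ, 0 < β ∧ ∀ t : ℝ, 1 ≤ t → ∀ n ∈ gwSupport p,
          condExp p n
              (fun T => (PTree.rootDeg T : ℝ) * (if t ≤ (PTree.Nk k T : ℝ) then 1 else 0)) ≤
            β * t ^ ((1 - (k : ℝ)) / 2))
    ∧ (MomentFinite p ((3 * (k : ℝ) + 3) / 2) →
        ∃ β : ℝ, 0 < β ∧ ∀ t : ℝ, 1 ≤ t → ∀ n ∈ gwSupport p,
          condExp p n
              (fun T => (PTree.rootDeg T : ℝ) * (if t ≤ (PTree.NkPlus k T : ℝ) then 1 else 0)) ≤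
            β * t ^ ((1 - (k : ℝ)) / 2)) := by
  have hsum : HasSum p 1 := by
    have h : Summable p := by
      by_contra h
      rw [tsum_eq_zero_of_not_summable h] at hp_sum
      exact zero_ne_one hp_sum
    exact hp_sum ▸ h.hasSum
  have hmean : HasSum (fun i : ℕ => (i : ℝ) * p i) 1 := by
    have h : Summable fun i : ℕ => (i : ℝ) * p i := by
      by_contra h
      rw [tsum_eq_zero_of_not_summable h] at hp_mean
      exact zero_ne_one hp_mean
    exact hp_mean ▸ h.hasSum
  obtain ⟨⟨C, hC0, hC⟩, hlow⟩ := exists_bounds_coeff_mk_pow hp_nonneg hsum hmean hp_sq hp_var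
  obtain ⟨c, hc0, hc⟩ := exists_le_treeSum hlow
  have hk' : (2 : ℝ) ≤ k := by exact_mod_cast hk
  refine ⟨fun hm => ?_, fun hm => ?_, fun hm => ?_, fun hm => ?_⟩
  · simp_rw [PTree.condProb_eq_sum]
    refine exists_weighted_tail_le hp_nonneg hC0 hC hc0 hc hk (w := fun _ => 1)
      (fun _ _ => one_pos) 0
      (summable_moment_one hp_nonneg hm hk (by push_cast; linarith)) (fun t T => ?_)
      fun t T ht h => ?_
    · split_ifs <;> simp
    · split_ifs at h with h'
      · exact PTree.one_le_rootDeg_and_le_Nk ht h'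
      · exact absurd h (lt_irrefl _)
  · simp_rw [PTree.condProb_eq_sum]
    refine exists_weighted_tail_le hp_nonneg hC0 hC hc0 hc hk (w := fun d => d)
      (fun d hd => by exact_mod_cast hd) 0
      (summable_moment_natCast hp_nonneg hm hk (by push_cast; linarith)) (fun t T => ?_)
      fun t T ht h => ?_
    · split_ifs <;> simp
    · split_ifs at h with h'
      · exact PTree.one_le_rootDeg_and_le_mul_Nk ht h'
      · exact absurd h (lt_irrefl _)
  · simp_rw [PTree.condExp_eq_sum]
    refine exists_weighted_tail_le hp_nonneg hC0 hC hc0 hc hk (w := fun _ => 1)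
      (fun _ _ => one_pos) 1
      (summable_moment_one hp_nonneg hm hk (by push_cast; linarith)) (fun t T => ?_)
      fun t T ht h => ?_
    · split_ifs <;> simp
    · split_ifs at h with h'
      · exact PTree.one_le_rootDeg_and_le_Nk ht h'
      · simp at h
  · simp_rw [PTree.condExp_eq_sum]
    refine exists_weighted_tail_le hp_nonneg hC0 hC hc0 hc hk (w := fun d => d)
      (fun d hd => by exact_mod_cast hd) 1
      (summable_moment_natCast hp_nonneg hm hk (by push_cast; linarith)) (fun t T => ?_)
      fun t T ht h => ?_
    · split_ifs <;> simp
    · split_ifs at h with h'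
      · exact PTree.one_le_rootDeg_and_le_mul_Nk ht h'
      · simp at h
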